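/- Let n ≥ 2, p ≥ 1 and λ ∈ (n/(n+p), 1), and set λ' = λ/(λ−1) (which is negative). Then for every nonzero nonnegative continuous function f : ℝⁿ → ℝ with compact support, ‖f‖₁^{n+λ'p} ≤ 2^{−n} b_{n,p,λ} ‖f‖_λ^{λ'p} ( ∫_{S^{n−1}} ( ∫_{ℝⁿ} f(x) |⟨x,ξ⟩|^p dx )^{−n/p} dξ )^{−p}. -/

import Mathlib

open MeasureTheory Real
open scoped RealInnerProductSpace

/-- The constant `R_{n,p}` from the Haberl–Schuster asymmetric `L_p` Blaschke–Santaló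
inequality: the value of the sharp bound, attained for the Euclidean ball. -/
noncomputable def Rnp (n : ℕ) (p : ℝ) : ℝ :=
  Real.pi ^ ((n : ℝ) / (2 * p) + n) / (Real.Gamma (((n : ℝ) + 2) / 2)) ^ (2 : ℕ) *
    (2 * Real.Gamma (((n : ℝ) + p + 2) / 2) /
      (Real.Gamma (((n : ℝ) + 2) / 2) * Real.Gamma ((p + 1) / 2))) ^ ((n : ℝ) / p)

/-- The constant `a_{n,p,λ}` for `λ ∈ (n/(n+p), 1)`, with `λ' = λ/(λ-1) < 0`; here
`B(m,l) = Γ(m)Γ(l)/Γ(m+l)` is the Beta function. -/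
noncomputable def anplLow (n : ℕ) (p lam : ℝ) : ℝ :=
  (((n : ℝ) / p) * ((n : ℝ) / ((lam / (lam - 1)) * p) + 1) ^ (lam / (lam - 1) - 1) *
      (lam * p / ((1 - lam) * (n : ℝ)) - 1) ^ ((n : ℝ) / p) *
      (Real.Gamma ((n : ℝ) / p) * Real.Gamma (-(lam / (lam - 1)) - (n : ℝ) / p + 1) /
        Real.Gamma ((n : ℝ) / p + (-(lam / (lam - 1)) - (n : ℝ) / p + 1)))) ^ p

/-- The constant `b_{n,p,λ} = (n/(n+p))^n a_{n,p,λ} R_{n,p}^p n^p` for `λ ∈ (n/(n+p), 1)`. -/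
noncomputable def bnplLow (n : ℕ) (p lam : ℝ) : ℝ :=
  ((n : ℝ) / ((n : ℝ) + p)) ^ (n : ℝ) * anplLow n p lam * Rnp n p ^ p * (n : ℝ) ^ p

section Helpers

open scoped ENNReal
open Set

/-- One-dimensional Brunn–Minkowski inequality for the midpoint set. -/
theorem volume_add_volume_le_of_midpoint_mem {A B C : Set ℝ} (hA : MeasurableSet A)
    (hB : MeasurableSet B) (hA0 : A.Nonempty) (hB0 : B.Nonempty)
    (h : ∀ x ∈ A, ∀ y ∈ B, (x + y) / 2 ∈ C) :
    volume A + volume B ≤ 2 * volume C := by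
  have key : ∀ K L : Set ℝ, K ⊆ A → L ⊆ B → IsCompact K → IsCompact L → K.Nonempty →
      L.Nonempty → volume K + volume L ≤ 2 * volume C := by
    intro K L hKA hLB hK hL hK0 hL0
    obtain ⟨a, haK, ha⟩ := hK.exists_isGreatest hK0
    obtain ⟨b, hbL, hb⟩ := hL.exists_isLeast hL0
    have e1 : volume K = volume ((fun x => x + b) '' K) := by
      rw [Set.image_add_right, measure_preimage_add_right]
    have e2 : volume L = volume ((fun x => a + x) '' L) := by
      rw [Set.image_add_left, measure_preimage_add]
    have hint : (fun x => x + b) '' K ∩ (fun x => a + x) '' L ⊆ {a + b} := by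
      rintro z ⟨⟨x, hx, rfl⟩, ⟨y, hy, hxy⟩⟩
      have h1 := ha hx
      have h2 := hb hy
      simp only at hxy
      simp only [mem_singleton_iff]
      linarith
    have hm : MeasurableSet ((fun x => a + x) '' L) :=
      (hL.image (by fun_prop)).measurableSet
    have e3 : volume K + volume L
        = volume ((fun x => x + b) '' K ∪ (fun x => a + x) '' L) := by
      rw [e1, e2, ← measure_union_add_inter _ hm, measure_mono_null hint (by simp), add_zero]
    rw [e3]
    have hsub : (fun x => x + b) '' K ∪ (fun x => a + x) '' L ⊆ (fun x => (2 : ℝ) • x) '' C := by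
      rintro z (⟨x, hx, rfl⟩ | ⟨y, hy, rfl⟩)
      · exact ⟨(x + b) / 2, h _ (hKA hx) _ (hLB hbL), by simp; ring⟩
      · exact ⟨(a + y) / 2, h _ (hKA haK) _ (hLB hy), by simp; ring⟩
    refine (measure_mono hsub).trans ?_
    rw [Set.image_smul, Measure.addHaar_smul]
    simp
  obtain ⟨x0, hx0⟩ := hA0
  obtain ⟨y0, hy0⟩ := hB0
  rw [hA.measure_eq_iSup_isCompact, hB.measure_eq_iSup_isCompact]
  have step : ∀ K : Set ℝ, K ⊆ A → IsCompact K → ∀ L : Set ℝ, L ⊆ B → IsCompact L →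
      volume K + volume L ≤ 2 * volume C := by
    intro K hKA hK L hLB hL
    refine le_trans ?_ (key (insert x0 K) (insert y0 L) (insert_subset hx0 hKA)
      (insert_subset hy0 hLB) (hK.insert _) (hL.insert _) ⟨x0, by simp⟩ ⟨y0, by simp⟩)
    gcongr <;> exact subset_insert _ _
  simp only [iSup_and', iSup_subtype']
  have : Nonempty {K : Set ℝ // K ⊆ A ∧ IsCompact K} := ⟨⟨∅, by simp⟩⟩
  have : Nonempty {K : Set ℝ // K ⊆ B ∧ IsCompact K} := ⟨⟨∅, by simp⟩⟩
  exact ENNReal.iSup_add_iSup_le fun K L => step K K.2.1 K.2.2 L L.2.1 L.2.2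

/-- One-dimensional Brunn–Minkowski inequality. -/
theorem volume_add_volume_le_of_add_mem {A B C : Set ℝ} (hA : MeasurableSet A)
    (hB : MeasurableSet B) (hA0 : A.Nonempty) (hB0 : B.Nonempty)
    (h : ∀ x ∈ A, ∀ y ∈ B, x + y ∈ C) : volume A + volume B ≤ volume C := by
  refine (volume_add_volume_le_of_midpoint_mem (C := (fun x => 2 * x) ⁻¹' C) hA hB hA0 hB0
    fun x hx y hy => ?_).trans ?_
  · simpa [mul_div_cancel₀] using h x hx y hy
  · rw [Real.volume_preimage_mul_left two_ne_zero, ← mul_assoc]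
    have : (2 : ℝ≥0∞) = ENNReal.ofReal 2 := by simp
    rw [this, ← ENNReal.ofReal_mul zero_le_two]
    norm_num

/-- Normalised one-dimensional Prékopa–Leindler inequality, in arithmetic form. -/
theorem lintegral_add_lintegral_le_of_midpoint {u v w : ℝ → ℝ}
    (hu : Measurable u) (hv : Measurable v) (hw : Measurable w)
    (hu0 : ∀ x, 0 ≤ u x) (hv0 : ∀ x, 0 ≤ v x) (hw0 : ∀ x, 0 ≤ w x)
    (hu1 : IsLUB (range u) 1) (hv1 : IsLUB (range v) 1)
    (h : ∀ τ, 0 < τ → ∀ x y, τ < u x → τ < v y → τ < w ((x + y) / 2)) :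
    (∫⁻ x, ENNReal.ofReal (u x)) + ∫⁻ x, ENNReal.ofReal (v x)
      ≤ 2 * ∫⁻ x, ENNReal.ofReal (w x) := by
  rw [lintegral_eq_lintegral_meas_lt _ (ae_of_all _ hu0) hu.aemeasurable,
    lintegral_eq_lintegral_meas_lt _ (ae_of_all _ hv0) hv.aemeasurable,
    lintegral_eq_lintegral_meas_lt _ (ae_of_all _ hw0) hw.aemeasurable,
    ← lintegral_const_mul', ← lintegral_add_left']
  rotate_left
  · exact (Antitone.measurable (f := fun t : ℝ => volume {a | t < u a}) fun a b hab =>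
      measure_mono fun x (hx : b < u x) => lt_of_le_of_lt hab hx).aemeasurable
  · simp
  refine setLIntegral_mono' measurableSet_Ioi fun τ hτ => ?_
  rcases lt_or_ge τ 1 with h1 | h1
  · obtain ⟨_, ⟨x, rfl⟩, hx⟩ := (lt_isLUB_iff hu1).1 h1
    obtain ⟨_, ⟨y, rfl⟩, hy⟩ := (lt_isLUB_iff hv1).1 h1
    exact volume_add_volume_le_of_midpoint_mem (measurableSet_lt measurable_const hu)
      (measurableSet_lt measurable_const hv) ⟨x, hx⟩ ⟨y, hy⟩
      fun a ha b hb => h τ hτ a b ha hb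
  · have e1 : {a | τ < u a} = ∅ := by
      ext a; simpa using (hu1.1 ⟨a, rfl⟩).trans h1
    have e2 : {a | τ < v a} = ∅ := by
      ext a; simpa using (hv1.1 ⟨a, rfl⟩).trans h1
    simp [e1, e2]

theorem ENNReal.mul_le_sq_of_add_le {X Y Z : ℝ≥0∞} (h : X + Y ≤ 2 * Z) : X * Y ≤ Z ^ 2 := by
  rcases eq_or_ne Z ∞ with rfl | hZ
  · simp
  have hXY : X + Y ≠ ∞ := ne_top_of_le_ne_top (by finiteness) h
  obtain ⟨hX, hY⟩ := ENNReal.add_ne_top.1 hXY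
  lift X to NNReal using hX
  lift Y to NNReal using hY
  lift Z to NNReal using hZ
  norm_cast at h ⊢
  have h' : (X : ℝ) + Y ≤ 2 * Z := by exact_mod_cast h
  have : (X : ℝ) * Y ≤ Z ^ 2 := by nlinarith [sq_nonneg ((X : ℝ) - Y), X.2, Y.2, Z.2]
  exact_mod_cast this

theorem isLUB_range_div_iSup {α : Type*} {u : α → ℝ≥0∞} (h0 : ⨆ x, u x ≠ 0)
    (h1 : ⨆ x, u x ≠ ∞) : IsLUB (range fun x => (u x / ⨆ x, u x).toReal) 1 := by
  constructor
  · rintro _ ⟨x, rfl⟩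
    refine ENNReal.toReal_le_of_le_ofReal zero_le_one ?_
    rw [ENNReal.ofReal_one]
    exact ENNReal.div_le_of_le_mul (by simpa using le_iSup u x)
  · intro M hM
    have h2 : ⨆ x, u x ≤ ENNReal.ofReal M * ⨆ x, u x := by
      refine iSup_le fun x => ?_
      rw [← ENNReal.div_le_iff h0 h1]
      have hfin : u x / ⨆ x, u x ≠ ∞ :=
        ENNReal.div_ne_top (ne_top_of_le_ne_top h1 (le_iSup u x)) h0
      rw [← ENNReal.ofReal_toReal hfin]
      exact ENNReal.ofReal_le_ofReal (hM ⟨x, rfl⟩)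
    by_contra hlt
    have h3 : ENNReal.ofReal M < 1 := by
      rw [← ENNReal.ofReal_one]
      exact (ENNReal.ofReal_lt_ofReal_iff one_pos).2 (not_le.1 hlt)
    have h4 := ENNReal.mul_lt_mul_left h0 h1 h3
    rw [one_mul] at h4
    exact absurd h2 (not_le.2 h4)

/-- One-dimensional Prékopa–Leindler inequality for bounded functions. -/
theorem prekopa_leindler_real_of_bdd {u v w : ℝ → ℝ≥0∞}
    (hu : Measurable u) (hv : Measurable v) (hw : Measurable w)
    (hu1 : ⨆ x, u x ≠ ∞) (hv1 : ⨆ x, v x ≠ ∞)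
    (h : ∀ x y, u x * v y ≤ w ((x + y) / 2) ^ 2) :
    (∫⁻ x, u x) * ∫⁻ x, v x ≤ (∫⁻ x, w x) ^ 2 := by
  set a := ⨆ x, u x with ha
  set b := ⨆ x, v x with hb
  rcases eq_or_ne a 0 with ha0 | ha0
  · have : ∀ x, u x = 0 := fun x => le_antisymm (ha0 ▸ le_iSup u x) bot_le
    simp [this]
  rcases eq_or_ne b 0 with hb0 | hb0
  · have : ∀ x, v x = 0 := fun x => le_antisymm (hb0 ▸ le_iSup v x) bot_le
    simp [this]
  set c := (a * b) ^ (1 / 2 : ℝ) with hc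
  have hab0 : a * b ≠ 0 := mul_ne_zero ha0 hb0
  have hab1 : a * b ≠ ∞ := ENNReal.mul_ne_top hu1 hv1
  have hc2 : c ^ 2 = a * b := by
    rw [hc, ← ENNReal.rpow_natCast, ← ENNReal.rpow_mul]; norm_num
  have hc0 : c ≠ 0 := by
    intro h0; rw [h0] at hc2; exact hab0 (by rw [← hc2]; simp)
  have hc1 : c ≠ ∞ := by
    intro h0; rw [h0] at hc2; exact hab1 (by rw [← hc2]; simp)
  have huf : ∀ x, u x / a ≠ ∞ := fun x =>
    ENNReal.div_ne_top (ne_top_of_le_ne_top hu1 (le_iSup u x)) ha0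
  have hvf : ∀ x, v x / b ≠ ∞ := fun x =>
    ENNReal.div_ne_top (ne_top_of_le_ne_top hv1 (le_iSup v x)) hb0
  have hwf : ∀ x, min (w x) c / c ≠ ∞ := fun x =>
    ENNReal.div_ne_top (ne_top_of_le_ne_top hc1 (min_le_right _ _)) hc0
  have key := lintegral_add_lintegral_le_of_midpoint
    (u := fun x => (u x / a).toReal) (v := fun x => (v x / b).toReal)
    (w := fun x => (min (w x) c / c).toReal) (by fun_prop) (by fun_prop) (by fun_prop)
    (fun _ => ENNReal.toReal_nonneg) (fun _ => ENNReal.toReal_nonneg)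
    (fun _ => ENNReal.toReal_nonneg) (isLUB_range_div_iSup ha0 hu1)
    (isLUB_range_div_iSup hb0 hv1) (by
      intro τ hτ x y hx hy
      have hx' : ENNReal.ofReal τ < u x / a := (ENNReal.ofReal_lt_iff_lt_toReal hτ.le (huf x)).2 hx
      have hy' : ENNReal.ofReal τ < v y / b := (ENNReal.ofReal_lt_iff_lt_toReal hτ.le (hvf y)).2 hy
      refine (ENNReal.ofReal_lt_iff_lt_toReal hτ.le (hwf _)).1 ?_
      rw [ENNReal.lt_div_iff_mul_lt (Or.inl hc0) (Or.inl hc1)]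
      have hx1 : ENNReal.ofReal τ < 1 := hx'.trans_le
        (ENNReal.div_le_of_le_mul (by simpa using le_iSup u x))
      rw [ENNReal.lt_div_iff_mul_lt (Or.inl ha0) (Or.inl hu1)] at hx'
      rw [ENNReal.lt_div_iff_mul_lt (Or.inl hb0) (Or.inl hv1)] at hy'
      refine lt_min ?_ ?_
      · by_contra hcon
        rw [not_lt] at hcon
        have h1 := (ENNReal.mul_lt_mul hx' hy').trans_le (h x y)
        have h2 : w ((x + y) / 2) ^ 2 ≤ (ENNReal.ofReal τ * c) ^ 2 := by gcongr
        have h3 := h1.trans_le h2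
        rw [mul_pow, hc2] at h3
        refine lt_irrefl _ (h3.trans_le (le_of_eq ?_))
        ring
      · simpa using ENNReal.mul_lt_mul_left hc0 hc1 hx1)
  simp only [ENNReal.ofReal_toReal (huf _), ENNReal.ofReal_toReal (hvf _),
    ENNReal.ofReal_toReal (hwf _)] at key
  simp only [div_eq_mul_inv] at key
  rw [lintegral_mul_const' _ _ (by simpa), lintegral_mul_const' _ _ (by simpa),
    lintegral_mul_const' _ _ (by simpa)] at key
  have key2 := ENNReal.mul_le_sq_of_add_le key
  have key3 : (∫⁻ x, u x) * (∫⁻ x, v x) * (c⁻¹) ^ 2 ≤ (∫⁻ x, w x) ^ 2 * (c⁻¹) ^ 2 := by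
    calc _ = (∫⁻ x, u x) * a⁻¹ * ((∫⁻ x, v x) * b⁻¹) := by
            rw [← ENNReal.inv_pow, hc2, ENNReal.mul_inv (Or.inl ha0) (Or.inl hu1)]; ring
      _ ≤ _ := key2
      _ ≤ _ := by
            rw [mul_pow]
            gcongr
            exact min_le_left _ _
  exact (ENNReal.mul_le_mul_iff_left (pow_ne_zero 2 (ENNReal.inv_ne_zero.2 hc1))
    (ENNReal.pow_ne_top (ENNReal.inv_ne_top.2 hc0))).1 key3

theorem lintegral_eq_iSup_min_natCast {α : Type*} [MeasurableSpace α] {μ : Measure α}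
    {u : α → ℝ≥0∞} (hu : Measurable u) :
    ∫⁻ x, u x ∂μ = ⨆ k : ℕ, ∫⁻ x, min (u x) k ∂μ := by
  rw [← lintegral_iSup]
  · congr 1 with x
    refine le_antisymm ?_ (iSup_le fun k => min_le_left _ _)
    rcases eq_or_ne (u x) ∞ with h | h
    · simp [h, ENNReal.iSup_natCast]
    · obtain ⟨k, hk⟩ := ENNReal.exists_nat_gt h
      exact le_iSup_of_le k (by simp [hk.le])
  · fun_prop
  · intro i j hij x
    dsimp only
    gcongr

/-- One-dimensional Prékopa–Leindler inequality. -/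
theorem prekopa_leindler_real {u v w : ℝ → ℝ≥0∞}
    (hu : Measurable u) (hv : Measurable v) (hw : Measurable w)
    (h : ∀ x y, u x * v y ≤ w ((x + y) / 2) ^ 2) :
    (∫⁻ x, u x) * ∫⁻ x, v x ≤ (∫⁻ x, w x) ^ 2 := by
  rw [lintegral_eq_iSup_min_natCast hu, lintegral_eq_iSup_min_natCast hv, ENNReal.iSup_mul]
  refine iSup_le fun k => ?_
  rw [ENNReal.mul_iSup]
  refine iSup_le fun l => ?_
  refine prekopa_leindler_real_of_bdd (by fun_prop) (by fun_prop) hw ?_ ?_ fun x y =>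
    le_trans (by gcongr <;> exact min_le_left _ _) (h x y)
  · exact ne_top_of_le_ne_top (ENNReal.natCast_ne_top k) (iSup_le fun x => min_le_right _ _)
  · exact ne_top_of_le_ne_top (ENNReal.natCast_ne_top l) (iSup_le fun x => min_le_right _ _)

theorem lintegral_fin_cons {d : ℕ} {F : (Fin (d + 1) → ℝ) → ℝ≥0∞} (hF : Measurable F) :
    ∫⁻ x, F x = ∫⁻ s : ℝ, ∫⁻ x' : Fin d → ℝ, F (Fin.cons s x') := by
  have hmp := (volume_preserving_piFinSuccAbove (fun _ : Fin (d + 1) => ℝ) 0).symm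
  rw [← hmp.lintegral_comp hF, Measure.volume_eq_prod,
    lintegral_prod (f := fun a => F ((MeasurableEquiv.piFinSuccAbove (fun _ => ℝ) 0).symm a))
      (hF.comp (MeasurableEquiv.measurable _)).aemeasurable]
  simp [MeasurableEquiv.piFinSuccAbove, Fin.insertNthEquiv]

theorem measurable_fin_cons {d : ℕ} :
    Measurable fun q : ℝ × (Fin d → ℝ) => (Fin.cons q.1 q.2 : Fin (d + 1) → ℝ) := by
  refine measurable_pi_iff.2 fun i => ?_
  refine Fin.cases ?_ (fun j => ?_) i
  · simpa using measurable_fst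
  · simp only [Fin.cons_succ]; fun_prop

/-- The midpoint case of the Prékopa–Leindler inequality. -/
theorem prekopa_leindler {d : ℕ} {u v w : (Fin d → ℝ) → ℝ≥0∞}
    (hu : Measurable u) (hv : Measurable v) (hw : Measurable w)
    (h : ∀ x y, u x * v y ≤ w ((1 / 2 : ℝ) • (x + y)) ^ 2) :
    (∫⁻ x, u x) * ∫⁻ x, v x ≤ (∫⁻ x, w x) ^ 2 := by
  induction d with
  | zero =>
    have hd : (volume : Measure (Fin 0 → ℝ)) = Measure.dirac 0 := by
      rw [volume_pi, Measure.pi_of_empty _ 0]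
    simp only [hd, lintegral_dirac]
    simpa using h 0 0
  | succ d ih =>
    have hm : ∀ {g : (Fin (d + 1) → ℝ) → ℝ≥0∞}, Measurable g →
        Measurable fun q : ℝ × (Fin d → ℝ) => g (Fin.cons q.1 q.2) :=
      fun hg => hg.comp measurable_fin_cons
    rw [lintegral_fin_cons hu, lintegral_fin_cons hv, lintegral_fin_cons hw]
    refine prekopa_leindler_real (hm hu).lintegral_prod_right' (hm hv).lintegral_prod_right'
      (hm hw).lintegral_prod_right' fun s t => ?_
    refine ih ((hm hu).comp measurable_prodMk_left) ((hm hv).comp measurable_prodMk_left)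
      ((hm hw).comp measurable_prodMk_left) fun x y => ?_
    refine (h _ _).trans (le_of_eq ?_)
    congr 2
    ext i
    refine Fin.cases ?_ (fun j => ?_) i
    · simp; ring
    · simp; ring

/-- The symmetric decreasing rearrangement of a nonnegative function on the line. -/
noncomputable def rearr (f : ℝ → ℝ) (s : ℝ) : ℝ :=
  sSup {τ | 0 ≤ τ ∧ ENNReal.ofReal (2 * |s|) < volume {u | τ < f u}}

/-- The centred open interval of length `V`. -/
def symInterval (V : ℝ≥0∞) : Set ℝ := {s | ENNReal.ofReal (2 * |s|) < V}

theorem measurableSet_symInterval (V : ℝ≥0∞) : MeasurableSet (symInterval V) :=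
  measurableSet_lt (by fun_prop) measurable_const

theorem symInterval_eq {V : ℝ≥0∞} (hV : V ≠ ∞) : symInterval V = {s | |s| < V.toReal / 2} := by
  ext s
  simp only [symInterval, mem_ofPred_eq]
  rw [ENNReal.ofReal_lt_iff_lt_toReal (by positivity) hV]
  constructor <;> intro h <;> linarith

theorem volume_symInterval {V : ℝ≥0∞} (hV : V ≠ ∞) : volume (symInterval V) = V := by
  have : symInterval V = Metric.ball 0 (V.toReal / 2) := by
    rw [symInterval_eq hV]; ext s; simp
  rw [this, Real.volume_ball, mul_div_cancel₀ _ two_ne_zero, ENNReal.ofReal_toReal hV]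

theorem rearr_nonneg (f : ℝ → ℝ) (s : ℝ) : 0 ≤ rearr f s :=
  Real.sSup_nonneg fun _ h => h.1

theorem rearr_bddAbove {f : ℝ → ℝ} {B : ℝ} (hB : ∀ u, f u ≤ B) (s : ℝ) :
    BddAbove {τ | 0 ≤ τ ∧ ENNReal.ofReal (2 * |s|) < volume {u | τ < f u}} := by
  refine ⟨B, fun τ hτ => ?_⟩
  by_contra hlt
  have : {u | τ < f u} = ∅ := by
    ext u
    simpa using (hB u).trans (not_le.1 hlt).le
  have h2 := hτ.2
  rw [this] at h2
  simp at h2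

theorem lt_rearr_iff {f : ℝ → ℝ} {B : ℝ} (hB : ∀ u, f u ≤ B) {τ : ℝ} (hτ : 0 ≤ τ) {s : ℝ} :
    τ < rearr f s ↔ s ∈ symInterval (volume {u | τ < f u}) := by
  constructor
  · intro h
    have hne : {τ | 0 ≤ τ ∧ ENNReal.ofReal (2 * |s|) < volume {u | τ < f u}}.Nonempty := by
      by_contra hemp
      rw [not_nonempty_iff_eq_empty] at hemp
      rw [rearr, hemp, Real.sSup_empty] at h
      exact absurd h (not_lt.2 hτ)
    obtain ⟨τ', h1, h2⟩ := exists_lt_of_lt_csSup hne h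
    exact h1.2.trans_le (measure_mono fun u (hu : τ' < f u) => h2.trans hu)
  · intro h
    have hU : {u | τ < f u} = ⋃ k : ℕ, {u | τ + 1 / ((k : ℝ) + 1) < f u} := by
      ext u
      simp only [mem_ofPred_eq, mem_iUnion]
      constructor
      · intro hu
        obtain ⟨k, hk⟩ := exists_nat_one_div_lt (sub_pos.2 hu)
        exact ⟨k, by linarith⟩
      · rintro ⟨k, hk⟩
        have : 0 < 1 / ((k : ℝ) + 1) := by positivity
        linarith
    have hmono : Monotone fun k : ℕ => {u | τ + 1 / ((k : ℝ) + 1) < f u} := by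
      intro i j hij u hu
      have : 1 / ((j : ℝ) + 1) ≤ 1 / ((i : ℝ) + 1) := by gcongr
      simp only [mem_ofPred_eq] at hu ⊢
      linarith
    simp only [symInterval, mem_ofPred_eq] at h
    rw [hU, hmono.measure_iUnion, lt_iSup_iff] at h
    obtain ⟨k, hk⟩ := h
    have h0 : 0 < 1 / ((k : ℝ) + 1) := by positivity
    exact (lt_add_of_pos_right τ h0).trans_le
      (le_csSup (rearr_bddAbove hB s) ⟨by positivity, hk⟩)

theorem rearr_neg (f : ℝ → ℝ) (s : ℝ) : rearr f (-s) = rearr f s := by simp [rearr]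

theorem measurable_rearr {f : ℝ → ℝ} {B : ℝ} (hB : ∀ u, f u ≤ B) : Measurable (rearr f) := by
  refine measurable_of_Ioi fun τ => ?_
  rcases lt_or_ge τ 0 with h | h
  · convert MeasurableSet.univ
    ext s
    simpa using h.trans_le (rearr_nonneg f s)
  · convert measurableSet_symInterval (volume {u | τ < f u})
    ext s
    exact lt_rearr_iff hB h

theorem volume_lt_rearr {f : ℝ → ℝ} {B : ℝ} (hB : ∀ u, f u ≤ B) {τ : ℝ} (hτ : 0 ≤ τ)
    (hfin : volume {u | τ < f u} ≠ ∞) :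
    volume {s | τ < rearr f s} = volume {u | τ < f u} := by
  have : {s | τ < rearr f s} = symInterval (volume {u | τ < f u}) := by
    ext s; exact lt_rearr_iff hB hτ
  rw [this, volume_symInterval hfin]

theorem volume_diff_symInterval {A : Set ℝ} (hA : MeasurableSet A) (hV : volume A ≠ ∞) :
    volume (symInterval (volume A) \ A) = volume (A \ symInterval (volume A)) := by
  have h1 := measure_sdiff_add_inter (μ := volume) (symInterval (volume A)) hA
  have h2 := measure_sdiff_add_inter (μ := volume) A (measurableSet_symInterval (volume A))
  rw [volume_symInterval hV, inter_comm] at h1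
  have h1 := h1.trans h2.symm
  exact (ENNReal.add_left_inj
    (ne_top_of_le_ne_top hV (measure_mono inter_subset_left))).1 h1

theorem setLIntegral_symInterval_le {A : Set ℝ} (hA : MeasurableSet A) (hV : volume A ≠ ∞)
    {Q : ℝ → ℝ≥0∞} (hQ : ∀ s t, |s| ≤ |t| → Q s ≤ Q t) :
    ∫⁻ s in symInterval (volume A), Q s ≤ ∫⁻ s in A, Q s := by
  set I := symInterval (volume A) with hI
  have hIm : MeasurableSet I := measurableSet_symInterval _
  rw [← lintegral_inter_add_sdiff Q I hA, ← lintegral_inter_add_sdiff Q A hIm, inter_comm]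
  gcongr 1
  have hl : (0 : ℝ) ≤ (volume A).toReal / 2 := by positivity
  calc ∫⁻ s in I \ A, Q s ≤ ∫⁻ s in I \ A, Q ((volume A).toReal / 2) := by
        refine setLIntegral_mono' (hIm.diff hA) fun s hs => hQ _ _ ?_
        have h1 := hs.1
        rw [hI, symInterval_eq hV] at h1
        rw [abs_of_nonneg hl]
        exact h1.le
    _ = ∫⁻ s in A \ I, Q ((volume A).toReal / 2) := by
        rw [setLIntegral_const, setLIntegral_const, volume_diff_symInterval hA hV]
    _ ≤ ∫⁻ s in A \ I, Q s := by
        refine setLIntegral_mono' (hA.diff hIm) fun s hs => hQ _ _ ?_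
        have h1 := hs.2
        rw [hI, symInterval_eq hV] at h1
        rw [abs_of_nonneg hl]
        exact not_lt.1 h1

theorem volume_symInterval_diff_eq_zero {A : Set ℝ} (hA : MeasurableSet A) (hV : volume A ≠ ∞)
    {Q : ℝ → ℝ≥0∞} (hQ : ∀ s t, |s| < |t| → Q s < Q t)
    (hQe : ∀ s t, |s| = |t| → Q s = Q t) (hQt : ∀ s, Q s ≠ ∞)
    (hle : ∫⁻ s in A, Q s ≤ ∫⁻ s in symInterval (volume A), Q s) :
    volume (symInterval (volume A) \ A) = 0 := by
  set I := symInterval (volume A) with hI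
  have hIm : MeasurableSet I := measurableSet_symInterval _
  have hQ' : ∀ s t, |s| ≤ |t| → Q s ≤ Q t := fun s t h =>
    h.lt_or_eq.elim (fun h => (hQ s t h).le) fun h => (hQe s t h).le
  have hl : (0 : ℝ) ≤ (volume A).toReal / 2 := by positivity
  have hlt : ∀ s ∈ I, Q s < Q ((volume A).toReal / 2) := by
    intro s hs
    rw [hI, symInterval_eq hV] at hs
    refine hQ _ _ ?_
    rw [abs_of_nonneg hl]
    exact hs
  by_contra hne
  rw [← lintegral_inter_add_sdiff Q I hA, ← lintegral_inter_add_sdiff Q A hIm,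
    inter_comm] at hle
  have hfin : ∫⁻ s in I ∩ A, Q s ≠ ∞ := by
    refine ne_top_of_le_ne_top (b := Q ((volume A).toReal / 2) * volume (I ∩ A)) ?_ ?_
    · exact ENNReal.mul_ne_top (hQt _) (ne_top_of_le_ne_top hV (measure_mono inter_subset_right))
    · rw [← setLIntegral_const]
      exact setLIntegral_mono' (hIm.inter hA) fun s hs => (hlt s hs.1).le
  have hle2 := (ENNReal.add_le_add_iff_left hfin).1 hle
  have h1 : ∫⁻ s in I \ A, Q s < ∫⁻ s in I \ A, Q ((volume A).toReal / 2) := by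
    refine setLIntegral_strict_mono (hIm.diff hA) hne measurable_const ?_
      (ae_of_all _ fun s hs => hlt s hs.1)
    refine ne_top_of_le_ne_top (b := Q ((volume A).toReal / 2) * volume (I \ A)) ?_ ?_
    · refine ENNReal.mul_ne_top (hQt _) ?_
      rw [hI, volume_diff_symInterval hA hV]
      exact ne_top_of_le_ne_top hV (measure_mono sdiff_subset)
    · rw [← setLIntegral_const]
      exact setLIntegral_mono' (hIm.diff hA) fun s hs => (hlt s hs.1).le
  have h2 : ∫⁻ s in I \ A, Q ((volume A).toReal / 2) ≤ ∫⁻ s in A \ I, Q s := by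
    rw [setLIntegral_const, volume_diff_symInterval hA hV, ← setLIntegral_const]
    refine setLIntegral_mono' (hA.diff hIm) fun s hs => hQ' _ _ ?_
    have h1 := hs.2
    rw [symInterval_eq hV] at h1
    rw [abs_of_nonneg hl]
    exact not_lt.1 h1
  exact absurd hle2 (not_le.2 (h1.trans_le h2))

theorem lintegral_mul_eq_lintegral_setLIntegral_lt {f : ℝ → ℝ} (hf : Measurable f)
    (hf0 : ∀ s, 0 ≤ f s) {Q : ℝ → ℝ≥0∞} (hQ : Measurable Q) :
    ∫⁻ s, ENNReal.ofReal (f s) * Q s = ∫⁻ τ in Ioi (0 : ℝ), ∫⁻ s in {s | τ < f s}, Q s := by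
  have h := lintegral_eq_lintegral_meas_lt (volume.withDensity Q) (ae_of_all _ hf0) hf.aemeasurable
  rw [lintegral_withDensity_eq_lintegral_mul _ hQ (by fun_prop)] at h
  simp only [Pi.mul_apply] at h
  simp_rw [mul_comm _ (Q _), h]
  refine lintegral_congr fun τ => ?_
  rw [withDensity_apply _ (measurableSet_lt measurable_const hf)]

theorem setLIntegral_lt_rearr_le {f : ℝ → ℝ} {B : ℝ} (hB : ∀ u, f u ≤ B) (hf : Measurable f)
    {Q : ℝ → ℝ≥0∞} (hQ : ∀ s t, |s| ≤ |t| → Q s ≤ Q t) (s₀ : ℝ) {τ : ℝ} (hτ : 0 < τ)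
    (hfin : volume {u | τ < f u} ≠ ∞) :
    ∫⁻ s in {s | τ < rearr f s}, Q s ≤ ∫⁻ s in {s | τ < f s}, Q (s - s₀) := by
  have h1 : {s | τ < rearr f s} = symInterval (volume {u | τ < f u}) := by
    ext s; exact lt_rearr_iff hB hτ.le
  have hm : MeasurableSet {u | τ < f u} := measurableSet_lt measurable_const hf
  have hpre : {s | τ < f s} = (fun s => s - s₀) ⁻¹' ((fun s => s + s₀) ⁻¹' {s | τ < f s}) := by
    ext s; simp
  have hm2 : MeasurableSet ((fun s => s + s₀) ⁻¹' {s | τ < f s}) :=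
    hm.preimage (by fun_prop)
  have hvol : volume ((fun s => s + s₀) ⁻¹' {s | τ < f s}) = volume {u | τ < f u} :=
    measure_preimage_add_right _ _ _
  have h2 : ∫⁻ s in {s | τ < f s}, Q (s - s₀)
      = ∫⁻ s in (fun s => s + s₀) ⁻¹' {s | τ < f s}, Q s := by
    conv_lhs => rw [hpre]
    exact (measurePreserving_sub_right volume s₀).setLIntegral_comp_preimage_emb
      (MeasurableEquiv.subRight s₀).measurableEmbedding Q _
  rw [h1, h2, ← hvol]
  exact setLIntegral_symInterval_le hm2 (by rwa [hvol]) hQ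

/-- Rearranging decreases integrals against even weights increasing in `|s|`, whatever the
centre of the weight was before rearranging. -/
theorem lintegral_rearr_mul_le {f : ℝ → ℝ} {B : ℝ} (hB : ∀ u, f u ≤ B) (hf : Measurable f)
    (hf0 : ∀ s, 0 ≤ f s) (hfin : ∀ τ, 0 < τ → volume {u | τ < f u} ≠ ∞)
    {Q : ℝ → ℝ≥0∞} (hQm : Measurable Q) (hQ : ∀ s t, |s| ≤ |t| → Q s ≤ Q t) (s₀ : ℝ) :
    ∫⁻ s, ENNReal.ofReal (rearr f s) * Q s ≤ ∫⁻ s, ENNReal.ofReal (f s) * Q (s - s₀) := by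
  rw [lintegral_mul_eq_lintegral_setLIntegral_lt (measurable_rearr hB) (rearr_nonneg f) hQm,
    lintegral_mul_eq_lintegral_setLIntegral_lt hf hf0 (Q := fun s => Q (s - s₀)) (by fun_prop)]
  exact setLIntegral_mono' measurableSet_Ioi fun τ hτ =>
    setLIntegral_lt_rearr_le hB hf hQ s₀ hτ (hfin τ hτ)

theorem lintegral_rearr_rpow {f : ℝ → ℝ} {B : ℝ} (hB : ∀ u, f u ≤ B) (hf : Measurable f)
    (hf0 : ∀ s, 0 ≤ f s) (hfin : ∀ τ, 0 < τ → volume {u | τ < f u} ≠ ∞) {r : ℝ} (hr : 0 < r) :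
    ∫⁻ s, ENNReal.ofReal (rearr f s ^ r) = ∫⁻ s, ENNReal.ofReal (f s ^ r) := by
  rw [lintegral_rpow_eq_lintegral_meas_lt_mul _ (ae_of_all _ (rearr_nonneg f))
    (measurable_rearr hB).aemeasurable hr,
    lintegral_rpow_eq_lintegral_meas_lt_mul _ (ae_of_all _ hf0) hf.aemeasurable hr]
  congr 1
  refine setLIntegral_congr_fun measurableSet_Ioi fun τ hτ => ?_
  rw [volume_lt_rearr hB (le_of_lt hτ) (hfin τ hτ)]

/-- A continuous function for which rearranging does not decrease the integral against a strictly
increasing weight is even. -/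
theorem even_of_lintegral_le_lintegral_rearr {f : ℝ → ℝ} {B : ℝ} (hB : ∀ u, f u ≤ B)
    (hf : Continuous f) (hf0 : ∀ s, 0 ≤ f s) (hfin : ∀ τ, 0 < τ → volume {u | τ < f u} ≠ ∞)
    {Q : ℝ → ℝ≥0∞} (hQm : Measurable Q) (hQ : ∀ s t, |s| < |t| → Q s < Q t)
    (hQe : ∀ s t, |s| = |t| → Q s = Q t) (hQt : ∀ s, Q s ≠ ∞)
    (hle : ∫⁻ s, ENNReal.ofReal (f s) * Q s ≤ ∫⁻ s, ENNReal.ofReal (rearr f s) * Q s)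
    (htop : ∫⁻ s, ENNReal.ofReal (rearr f s) * Q s ≠ ∞) (s : ℝ) : f (-s) = f s := by
  have hQ' : ∀ s t, |s| ≤ |t| → Q s ≤ Q t := fun s t h =>
    h.lt_or_eq.elim (fun h => (hQ s t h).le) fun h => (hQe s t h).le
  rw [lintegral_mul_eq_lintegral_setLIntegral_lt (measurable_rearr hB) (rearr_nonneg f) hQm]
    at hle htop
  rw [lintegral_mul_eq_lintegral_setLIntegral_lt hf.measurable hf0 hQm] at hle
  have hae := ae_eq_of_ae_le_of_lintegral_le
    ((ae_restrict_iff' measurableSet_Ioi).2 (ae_of_all _ fun τ hτ => by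
      simpa using setLIntegral_lt_rearr_le hB hf.measurable hQ' 0 hτ (hfin τ hτ))) htop
    (Antitone.measurable (f := fun τ => ∫⁻ s in {s | τ < f s}, Q s) fun a b hab =>
      lintegral_mono_set fun x (hx : b < f x) => lt_of_le_of_lt hab hx).aemeasurable hle
  rw [Filter.EventuallyEq, ae_restrict_iff' measurableSet_Ioi] at hae
  have main : ∀ s, f s ≤ f (-s) := by
    intro s
    by_contra hlt
    rw [not_le] at hlt
    have hpos : volume (Ioo (f (-s)) (f s)) ≠ 0 := by simpa using hlt
    obtain ⟨τ, hτ, hτe⟩ : ∃ τ ∈ Ioo (f (-s)) (f s), (τ ∈ Ioi (0 : ℝ) →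
        ∫⁻ s in {s | τ < rearr f s}, Q s = ∫⁻ s in {s | τ < f s}, Q s) := by
      by_contra hcon
      push Not at hcon
      refine hpos (measure_mono_null (fun τ hτ => ?_) hae)
      simpa using hcon τ hτ
    have hτ0 : 0 < τ := (hf0 _).trans_lt hτ.1
    have hτe := hτe hτ0
    set A := {s | τ < f s} with hA
    have h1 : {s | τ < rearr f s} = symInterval (volume A) := by
      ext s; exact lt_rearr_iff hB hτ0.le
    rw [h1] at hτe
    have hAm : MeasurableSet A := measurableSet_lt measurable_const hf.measurable
    have hz := volume_symInterval_diff_eq_zero hAm (hfin τ hτ0) hQ hQe hQt hτe.ge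
    have hz2 := hz
    rw [volume_diff_symInterval hAm (hfin τ hτ0)] at hz2
    set U := {x | τ < f x ∧ f (-x) < τ} with hU
    have hUo : IsOpen U :=
      (isOpen_lt continuous_const hf).inter (isOpen_lt (hf.comp continuous_neg) continuous_const)
    have hU0 : volume U ≠ 0 := (hUo.measure_pos volume ⟨s, hτ.2, hτ.1⟩).ne'
    have hsub : U ⊆ (A \ symInterval (volume A)) ∪ Neg.neg ⁻¹' (symInterval (volume A) \ A) := by
      intro x hx
      by_cases hxi : x ∈ symInterval (volume A)
      · refine Or.inr ⟨?_, ?_⟩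
        · simpa [symInterval] using hxi
        · simpa [hA] using hx.2.le
      · exact Or.inl ⟨hx.1, hxi⟩
    refine hU0 (measure_mono_null hsub (measure_union_null hz2 ?_))
    rw [Measure.measure_preimage_neg, hz]
  exact le_antisymm (by simpa using main (-s)) (main s)

/-- The point of Euclidean space with first coordinate `s` and remaining coordinates `x`. -/
noncomputable def vec {d : ℕ} (s : ℝ) (x : Fin d → ℝ) : EuclideanSpace ℝ (Fin (d + 1)) :=
  WithLp.toLp 2 (Fin.cons s x)

/-- All coordinates but the first. -/
def tail {d : ℕ} (x : EuclideanSpace ℝ (Fin (d + 1))) : Fin d → ℝ := fun i => x i.succ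

section Vec

variable {d : ℕ}

@[simp] theorem vec_zero (s : ℝ) (x : Fin d → ℝ) : vec s x 0 = s := by simp [vec]

@[simp] theorem vec_succ (s : ℝ) (x : Fin d → ℝ) (i : Fin d) : vec s x i.succ = x i := by
  simp [vec]

@[simp] theorem tail_vec (s : ℝ) (x : Fin d → ℝ) : tail (vec s x) = x := by
  ext i; simp [tail]

theorem vec_tail (x : EuclideanSpace ℝ (Fin (d + 1))) : vec (x 0) (tail x) = x := by
  ext i
  refine Fin.cases ?_ (fun j => ?_) i <;> simp [tail]

theorem inner_vec (s t : ℝ) (x y : Fin d → ℝ) : ⟪vec s x, vec t y⟫ = x ⬝ᵥ y + s * t := by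
  simp [PiLp.inner_apply, Fin.sum_univ_succ, dotProduct, mul_comm, add_comm]

theorem norm_vec_sq (s : ℝ) (x : Fin d → ℝ) : ‖vec s x‖ ^ 2 = x ⬝ᵥ x + s ^ 2 := by
  rw [← real_inner_self_eq_norm_sq, inner_vec, sq]

theorem dist_vec_sq (s t : ℝ) (x y : Fin d → ℝ) :
    dist (vec s x) (vec t y) ^ 2 = (x - y) ⬝ᵥ (x - y) + (s - t) ^ 2 := by
  rw [dist_eq_norm, ← norm_vec_sq]
  congr 2
  ext i
  refine Fin.cases ?_ (fun j => ?_) i <;> simp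

theorem continuous_vec : Continuous fun q : ℝ × (Fin d → ℝ) => vec q.1 q.2 := by
  refine (PiLp.continuous_toLp 2 _).comp (continuous_pi fun i => ?_)
  refine Fin.cases ?_ (fun j => ?_) i
  · simpa using continuous_fst
  · simp only [Fin.cons_succ]; fun_prop

@[fun_prop]
theorem continuous_vec_left (x : Fin d → ℝ) : Continuous fun s => vec s x :=
  continuous_vec.comp (Continuous.prodMk_left x)

@[fun_prop]
theorem continuous_vec_right (s : ℝ) : Continuous fun x : Fin d → ℝ => vec s x :=
  continuous_vec.comp (Continuous.prodMk_right s)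

theorem lintegral_vec' {F : EuclideanSpace ℝ (Fin (d + 1)) → ℝ≥0∞} (hF : Measurable F) :
    ∫⁻ x, F x = ∫⁻ s : ℝ, ∫⁻ x : Fin d → ℝ, F (vec s x) := by
  rw [← (PiLp.volume_preserving_toLp (Fin (d + 1))).lintegral_comp hF]
  exact lintegral_fin_cons (hF.comp (PiLp.continuous_toLp 2 _).measurable)

theorem lintegral_vec {F : EuclideanSpace ℝ (Fin (d + 1)) → ℝ≥0∞} (hF : Measurable F) :
    ∫⁻ x, F x = ∫⁻ x : Fin d → ℝ, ∫⁻ s : ℝ, F (vec s x) := by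
  rw [lintegral_vec' hF]
  exact lintegral_lintegral_swap (hF.comp continuous_vec.measurable).aemeasurable

end Vec

/-- Steiner symmetrization of a function in the direction of the first coordinate. -/
noncomputable def steiner {d : ℕ} (f : EuclideanSpace ℝ (Fin (d + 1)) → ℝ)
    (x : EuclideanSpace ℝ (Fin (d + 1))) : ℝ :=
  rearr (fun s => f (vec s (tail x))) (x 0)

/-- Nonnegative continuous functions bounded by `B` and vanishing outside the ball of
radius `R`. -/
structure IsProfile {E : Type*} [NormedAddCommGroup E] (B R : ℝ) (f : E → ℝ) : Prop where
  continuous : Continuous f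
  nonneg : ∀ x, 0 ≤ f x
  le : ∀ x, f x ≤ B
  zero : ∀ x, R ≤ ‖x‖ → f x = 0

section Steiner

variable {d : ℕ} {B R : ℝ} {f : EuclideanSpace ℝ (Fin (d + 1)) → ℝ}

theorem steiner_vec (f : EuclideanSpace ℝ (Fin (d + 1)) → ℝ) (s : ℝ) (x : Fin d → ℝ) :
    steiner f (vec s x) = rearr (fun s => f (vec s x)) s := by simp [steiner]

theorem IsProfile.volume_fiber_ne_top (hf : IsProfile B R f) (x : Fin d → ℝ) {τ : ℝ}
    (hτ : 0 ≤ τ) : volume {u | τ < f (vec u x)} ≠ ∞ := by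
  have : {u | τ < f (vec u x)} ⊆ Metric.closedBall 0 R := by
    intro u hu
    simp only [mem_ofPred_eq] at hu
    by_contra hcon
    have h1 : R ≤ ‖vec u x‖ := by
      simp only [Metric.mem_closedBall, dist_zero_right, not_le, Real.norm_eq_abs] at hcon
      refine hcon.le.trans ?_
      refine abs_le_of_sq_le_sq ?_ (norm_nonneg _)
      rw [norm_vec_sq]
      have : 0 ≤ x ⬝ᵥ x := Finset.sum_nonneg fun i _ => mul_self_nonneg _
      linarith
    rw [hf.zero _ h1] at hu
    linarith
  exact ne_top_of_le_ne_top measure_closedBall_lt_top.ne (measure_mono this)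

theorem steiner_le_add (hfc : Continuous f) (hB : ∀ x, f x ≤ B) {δ ε : ℝ}
    (hδ : ∀ x y, dist x y ≤ δ → |f x - f y| ≤ ε) (hε : 0 ≤ ε)
    {x y : EuclideanSpace ℝ (Fin (d + 1))}
    (hxy : dist x y ≤ δ) : steiner f x ≤ steiner f y + ε := by
  by_contra! hcon
  obtain ⟨s, x, rfl⟩ : ∃ s x', x = vec s x' := ⟨_, _, (vec_tail x).symm⟩
  obtain ⟨t, y, rfl⟩ : ∃ s x', y = vec s x' := ⟨_, _, (vec_tail y).symm⟩
  rw [steiner_vec, steiner_vec] at hcon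
  set τ := rearr (fun s => f (vec s y)) t with hτ
  have hτ0 : 0 ≤ τ := rearr_nonneg _ _
  rw [lt_rearr_iff (fun u => hB _) (by positivity)] at hcon
  simp only [symInterval, mem_ofPred_eq] at hcon
  have hm : ∀ (τ : ℝ) (x : Fin d → ℝ), MeasurableSet {u | τ < f (vec u x)} := fun τ x =>
    measurableSet_lt measurable_const (by fun_prop)
  have hbm : volume {u | τ + ε < f (vec u x)} + volume (Metric.closedBall (0 : ℝ) |s - t|)
      ≤ volume {u | τ < f (vec u y)} := by
    refine volume_add_volume_le_of_add_mem (hm _ _) Metric.isClosed_closedBall.measurableSet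
      (nonempty_of_measure_ne_zero (bot_le.trans_lt hcon).ne') ⟨0, by simp⟩ fun u hu v hv => ?_
    simp only [mem_ofPred_eq] at hu ⊢
    have h1 : dist (vec u x) (vec (u + v) y) ≤ δ := by
      refine le_trans ?_ hxy
      refine abs_le_of_sq_le_sq' ?_ dist_nonneg |>.2
      rw [dist_vec_sq, dist_vec_sq]
      have : (u - (u + v)) ^ 2 ≤ (s - t) ^ 2 := by
        refine sq_le_sq.2 ?_
        simpa using hv
      linarith
    have h2 := (abs_le.1 (hδ _ _ h1)).2
    linarith
  have h3 : t ∈ symInterval (volume {u | τ < f (vec u y)}) := by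
    refine lt_of_lt_of_le ?_ hbm
    rw [Real.volume_closedBall]
    calc ENNReal.ofReal (2 * |t|) ≤ ENNReal.ofReal (2 * |s| + 2 * |s - t|) := by
          refine ENNReal.ofReal_le_ofReal ?_
          have := abs_sub_abs_le_abs_sub t s
          rw [abs_sub_comm] at this
          linarith
      _ = ENNReal.ofReal (2 * |s|) + ENNReal.ofReal (2 * |s - t|) :=
          ENNReal.ofReal_add (by positivity) (by positivity)
      _ < _ := ENNReal.add_lt_add_right ENNReal.ofReal_ne_top hcon
  rw [← lt_rearr_iff (fun u => hB _) hτ0] at h3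
  exact lt_irrefl _ h3

theorem abs_steiner_sub_le (hfc : Continuous f) (hB : ∀ x, f x ≤ B) {δ ε : ℝ}
    (hδ : ∀ x y, dist x y ≤ δ → |f x - f y| ≤ ε)
    (x y : EuclideanSpace ℝ (Fin (d + 1)))
    (hxy : dist x y ≤ δ) : |steiner f x - steiner f y| ≤ ε := by
  have hε : 0 ≤ ε := (abs_nonneg _).trans (hδ _ _ hxy)
  have h1 := steiner_le_add hfc hB hδ hε hxy
  have h2 := steiner_le_add hfc hB hδ hε ((dist_comm y x).trans_le hxy)
  exact abs_le.2 ⟨by linarith, by linarith⟩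

theorem IsProfile.uniformContinuous {E : Type*} [NormedAddCommGroup E] [ProperSpace E]
    {f : E → ℝ} (hf : IsProfile B R f) : UniformContinuous f := by
  refine hf.continuous.uniformContinuous_of_tendsto_cocompact (x := 0) ?_
  refine tendsto_const_nhds.congr' ?_
  filter_upwards [(isCompact_closedBall (0 : E) R).compl_mem_cocompact] with x hx
  exact (hf.zero x (by simpa using (not_le.1 (by simpa using hx : ¬ ‖x‖ ≤ R)).le)).symm

theorem IsProfile.steiner (hf : IsProfile B R f) : IsProfile B R (steiner f) where
  continuous := by
    have := Metric.uniformContinuous_iff_le.1 hf.uniformContinuous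
    refine (Metric.uniformContinuous_iff_le.2 fun ε hε => ?_).continuous
    obtain ⟨δ, hδ, h⟩ := this ε hε
    exact ⟨δ, hδ, fun a b hab => abs_steiner_sub_le hf.continuous hf.le (fun x y h' => h h') a b hab⟩
  nonneg x := rearr_nonneg _ _
  le x := by
    refine Real.sSup_le (fun τ hτ => ?_) ((hf.nonneg 0).trans (hf.le 0))
    by_contra! hlt
    have h2 := hτ.2
    have : {u | τ < f (vec u (tail x))} = ∅ := by
      ext u
      simpa using (hf.le _).trans hlt.le
    rw [this] at h2
    simp at h2
  zero x hx := by
    obtain ⟨s, x, rfl⟩ : ∃ s x', x = vec s x' := ⟨_, _, (vec_tail x).symm⟩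
    by_contra hne
    have hpos : 0 < rearr (fun s => f (vec s x)) s := by
      rw [steiner_vec] at hne
      exact lt_of_le_of_ne (rearr_nonneg _ _) (Ne.symm hne)
    rw [lt_rearr_iff (fun u => hf.le _) le_rfl] at hpos
    have hsub : {u | 0 < f (vec u x)} ⊆ Metric.ball 0 |s| := by
      intro u hu
      by_contra hcon
      have h2 : R ≤ ‖vec u x‖ := by
        refine hx.trans (abs_le_of_sq_le_sq' ?_ (norm_nonneg _)).2
        rw [norm_vec_sq, norm_vec_sq]
        have : s ^ 2 ≤ u ^ 2 := sq_le_sq.2 (by simpa using hcon)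
        linarith
      rw [mem_ofPred_eq, hf.zero _ h2] at hu
      exact lt_irrefl _ hu
    have := hpos.trans_le (measure_mono hsub)
    rw [Real.volume_ball] at this
    exact lt_irrefl _ this

theorem lintegral_steiner_rpow (hf : IsProfile B R f) {r : ℝ} (hr : 0 < r) :
    ∫⁻ x, ENNReal.ofReal (steiner f x ^ r) = ∫⁻ x, ENNReal.ofReal (f x ^ r) := by
  have h1 := hf.continuous.measurable
  have h2 := hf.steiner.continuous.measurable
  rw [lintegral_vec (by fun_prop), lintegral_vec (by fun_prop)]
  refine lintegral_congr fun x => ?_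
  simp only [steiner_vec]
  exact lintegral_rearr_rpow (f := fun s => f (vec s x)) (fun u => hf.le _) (by fun_prop)
    (fun u => hf.nonneg _) (fun τ hτ => hf.volume_fiber_ne_top x hτ.le) hr

theorem norm_vec_le_norm_vec {s t : ℝ} (x : Fin d → ℝ) (h : |s| ≤ |t|) :
    ‖vec s x‖ ≤ ‖vec t x‖ := by
  refine (abs_le_of_sq_le_sq' ?_ (norm_nonneg _)).2
  rw [norm_vec_sq, norm_vec_sq]
  have := sq_le_sq.2 h
  linarith

theorem norm_vec_lt_norm_vec {s t : ℝ} (x : Fin d → ℝ) (h : |s| < |t|) :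
    ‖vec s x‖ < ‖vec t x‖ := by
  refine (abs_lt_of_sq_lt_sq' ?_ (norm_nonneg _)).2
  rw [norm_vec_sq, norm_vec_sq]
  have := sq_lt_sq.2 h
  linarith

theorem lintegral_fiber_steiner_mul_norm_le (hf : IsProfile B R f) (x : Fin d → ℝ) :
    ∫⁻ s, ENNReal.ofReal (steiner f (vec s x)) * ENNReal.ofReal ‖vec s x‖
      ≤ ∫⁻ s, ENNReal.ofReal (f (vec s x)) * ENNReal.ofReal ‖vec s x‖ := by
  simp only [steiner_vec]
  have h1 := hf.continuous.measurable
  simpa using lintegral_rearr_mul_le (f := fun s => f (vec s x)) (fun u => hf.le _)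
    (by fun_prop) (fun u => hf.nonneg _) (fun τ hτ => hf.volume_fiber_ne_top x hτ.le)
    (Q := fun s => ENNReal.ofReal ‖vec s x‖) (by fun_prop)
    (fun s t h => ENNReal.ofReal_le_ofReal (norm_vec_le_norm_vec x h)) 0

/-- If Steiner symmetrization does not decrease the first moment of `f`, then `f` is even in the
first coordinate. -/
theorem even_of_lintegral_le_steiner (hf : IsProfile B R f)
    (hle : ∫⁻ x, ENNReal.ofReal (f x) * ENNReal.ofReal ‖x‖
      ≤ ∫⁻ x, ENNReal.ofReal (steiner f x) * ENNReal.ofReal ‖x‖)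
    (htop : ∫⁻ x, ENNReal.ofReal (steiner f x) * ENNReal.ofReal ‖x‖ ≠ ∞)
    (s : ℝ) (x : Fin d → ℝ) : f (vec (-s) x) = f (vec s x) := by
  have h1 := hf.continuous.measurable
  have h2 := hf.steiner.continuous.measurable
  have hm : ∀ {g : EuclideanSpace ℝ (Fin (d + 1)) → ℝ}, Measurable g → Measurable
      fun x : Fin d → ℝ => ∫⁻ s, ENNReal.ofReal (g (vec s x)) * ENNReal.ofReal ‖vec s x‖ := by
    intro g hg
    have : Measurable fun q : (Fin d → ℝ) × ℝ =>
        ENNReal.ofReal (g (vec q.2 q.1)) * ENNReal.ofReal ‖vec q.2 q.1‖ := by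
      have hv : Measurable fun q : (Fin d → ℝ) × ℝ => vec q.2 q.1 :=
        continuous_vec.measurable.comp measurable_swap
      fun_prop
    exact this.lintegral_prod_right'
  rw [lintegral_vec (by fun_prop), lintegral_vec (by fun_prop)] at hle
  rw [lintegral_vec (by fun_prop)] at htop
  have hae := ae_eq_of_ae_le_of_lintegral_le
    (ae_of_all _ (lintegral_fiber_steiner_mul_norm_le hf)) htop (hm h1).aemeasurable hle
  have hfin := ae_lt_top (hm h2) htop
  have heven : ∀ᵐ x : Fin d → ℝ, f (vec (-s) x) = f (vec s x) := by
    filter_upwards [hae, hfin] with x hx hx2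
    simp only [steiner_vec] at hx hx2
    refine even_of_lintegral_le_lintegral_rearr (f := fun s => f (vec s x))
      (Q := fun s => ENNReal.ofReal ‖vec s x‖) (fun u => hf.le _)
      (hf.continuous.comp (by fun_prop)) (fun u => hf.nonneg _)
      (fun τ hτ => hf.volume_fiber_ne_top x hτ.le) (by fun_prop) (fun s t h => ?_)
      (fun s t h => ?_) (fun _ => ENNReal.ofReal_ne_top) hx.ge hx2.ne s
    · exact (ENNReal.ofReal_lt_ofReal_iff ((norm_nonneg _).trans_lt
        (norm_vec_lt_norm_vec x h))).2 (norm_vec_lt_norm_vec x h)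
    · rw [le_antisymm (norm_vec_le_norm_vec x h.le) (norm_vec_le_norm_vec x h.ge)]
  have := Continuous.ae_eq_iff_eq (μ := (volume : Measure (Fin d → ℝ)))
    (f := fun x => f (vec (-s) x)) (g := fun x => f (vec s x))
    (hf.continuous.comp (by fun_prop)) (hf.continuous.comp (by fun_prop))
  exact congrFun (this.1 heven) x

end Steiner

section Moment

theorem convexOn_abs_add_mul_rpow {p : ℝ} (hp : 1 ≤ p) (c t : ℝ) :
    ConvexOn ℝ univ fun v : ℝ => |c + v * t| ^ p := by
  have h1 : ConvexOn ℝ univ fun v : ℝ => |v| ^ p := by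
    have := ((convexOn_rpow hp).subset (fun _ h => ?_) ?_).comp (convexOn_univ_norm (E := ℝ))
      ((monotoneOn_rpow_Ici_of_exponent_nonneg (by linarith)).mono fun _ h => ?_)
    · exact this
    · obtain ⟨x, -, rfl⟩ := h; exact norm_nonneg x
    · exact (isConnected_univ.image _ continuous_norm.continuousOn).isPreconnected.ordConnected.convex
    · obtain ⟨x, -, rfl⟩ := h; exact norm_nonneg x
  refine ⟨convex_univ, fun x _ y _ α β hα hβ hαβ => ?_⟩
  have := h1.2 (mem_univ (c + x * t)) (mem_univ (c + y * t)) hα hβ hαβ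
  refine le_trans (le_of_eq ?_) this
  simp only [smul_eq_mul]
  congr 2
  linear_combination (-c) * hαβ

theorem abs_rpow_add_abs_rpow_le {p : ℝ} (hp : 1 ≤ p) (c t : ℝ) {v w : ℝ} (h : |v| ≤ |w|) :
    |c + v * t| ^ p + |c - v * t| ^ p ≤ |c + w * t| ^ p + |c - w * t| ^ p := by
  have h1 : ConvexOn ℝ univ fun v : ℝ => |c + v * t| ^ p + |c + v * (-t)| ^ p :=
    (convexOn_abs_add_mul_rpow hp c t).add (convexOn_abs_add_mul_rpow hp c (-t))
  have h2 := h1.le_max_of_mem_Icc (mem_univ (-|w|)) (mem_univ |w|) (z := v) (abs_le.1 h)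
  rcases abs_cases w with ⟨hw, -⟩ | ⟨hw, -⟩ <;> rw [hw] at h2 <;>
    simpa [← sub_eq_add_neg, add_comm] using h2

/-- The `p`-th absolute moment of `f` in the direction `y`. -/
noncomputable def moment {E : Type*} [NormedAddCommGroup E] [InnerProductSpace ℝ E]
    [MeasureSpace E] (p : ℝ) (f : E → ℝ) (y : E) : ℝ :=
  ∫ x, f x * |⟪x, y⟫| ^ p

theorem IsProfile.hasCompactSupport {E : Type*} [NormedAddCommGroup E] [ProperSpace E]
    {B R : ℝ} {f : E → ℝ} (hf : IsProfile B R f) : HasCompactSupport f :=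
  HasCompactSupport.intro (isCompact_closedBall 0 R) fun x hx =>
    hf.zero x (not_le.1 (by simpa using hx : ¬ ‖x‖ ≤ R)).le

theorem moment_neg {E : Type*} [NormedAddCommGroup E] [InnerProductSpace ℝ E]
    [MeasureSpace E] (p : ℝ) (f : E → ℝ) (y : E) : moment p f (-y) = moment p f y := by
  simp [moment]

variable {E : Type*} [NormedAddCommGroup E] [InnerProductSpace ℝ E] [FiniteDimensional ℝ E]
  [MeasurableSpace E] [BorelSpace E] {B R p : ℝ} {f : E → ℝ}

theorem IsProfile.integrable_mul (hf : IsProfile B R f) {g : E → ℝ} (hg : Continuous g) :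
    Integrable fun x => f x * g x :=
  (hf.continuous.mul hg).integrable_of_hasCompactSupport hf.hasCompactSupport.mul_right

theorem IsProfile.integrable_moment (hf : IsProfile B R f) (hp : 0 ≤ p) (y : E) :
    Integrable fun x => f x * |⟪x, y⟫| ^ p :=
  hf.integrable_mul ((continuous_id.inner continuous_const).abs.rpow_const fun _ => Or.inr hp)

theorem IsProfile.moment_nonneg (hf : IsProfile B R f) (p : ℝ) (y : E) : 0 ≤ moment p f y :=
  integral_nonneg fun x => mul_nonneg (hf.nonneg x) (by positivity)

theorem IsProfile.ofReal_moment (hf : IsProfile B R f) (hp : 0 ≤ p) (y : E) :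
    ENNReal.ofReal (moment p f y) = ∫⁻ x, ENNReal.ofReal (f x) * ENNReal.ofReal (|⟪x, y⟫| ^ p) := by
  rw [moment, ofReal_integral_eq_lintegral_ofReal (hf.integrable_moment hp y)
    (ae_of_all _ fun x => mul_nonneg (hf.nonneg x) (by positivity))]
  exact lintegral_congr fun x => ENNReal.ofReal_mul (hf.nonneg x)

theorem measurable_moment (hf : Continuous f) (hp : 0 ≤ p) : Measurable (moment p f) := by
  have : Continuous fun q : E × E => f q.2 * |⟪q.2, q.1⟫| ^ p :=
    (hf.comp continuous_snd).mul
      ((continuous_snd.inner continuous_fst).abs.rpow_const fun _ => Or.inr hp)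
  exact this.stronglyMeasurable.integral_prod_right.measurable

end Moment

section SteinerMoment

variable {d : ℕ} {B R p : ℝ} {f : EuclideanSpace ℝ (Fin (d + 1)) → ℝ}

theorem two_mul_lintegral_fiber_steiner_le (hf : IsProfile B R f) (hp : 1 ≤ p) (t : ℝ)
    (x : Fin d → ℝ) (a b : ℝ) :
    2 * ∫⁻ s, ENNReal.ofReal (steiner f (vec s x)) * ENNReal.ofReal (|(a + b) / 2 + s * t| ^ p)
      ≤ (∫⁻ s, ENNReal.ofReal (f (vec s x)) * ENNReal.ofReal (|a + s * t| ^ p))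
        + ∫⁻ s, ENNReal.ofReal (f (vec s x)) * ENNReal.ofReal (|b - s * t| ^ p) := by
  have hp0 : 0 ≤ p := by linarith
  have h1 := hf.continuous.measurable
  have h2 := hf.steiner.continuous.measurable
  set c := (a + b) / 2 with hc
  set Q : ℝ → ℝ≥0∞ := fun v => ENNReal.ofReal (|c + v * t| ^ p + |c - v * t| ^ p) with hQ
  obtain ⟨s₀, hs₀⟩ : ∃ s₀, ∀ s, |c + (s - s₀) * t| ^ p + |c - (s - s₀) * t| ^ p
      ≤ |a + s * t| ^ p + |b - s * t| ^ p := by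
    by_cases ht : t = 0
    · refine ⟨0, fun s => ?_⟩
      subst ht
      have := (convexOn_abs_add_mul_rpow hp 0 1).2 (mem_univ a) (mem_univ b)
        (by norm_num : (0 : ℝ) ≤ 1 / 2) (by norm_num : (0 : ℝ) ≤ 1 / 2) (by norm_num)
      simp only [smul_eq_mul, mul_one, zero_add, mul_zero, add_zero, sub_zero] at this ⊢
      rw [show 1 / 2 * a + 1 / 2 * b = c by rw [hc]; ring] at this
      linarith
    · refine ⟨(b - a) / 2 / t, fun s => le_of_eq ?_⟩
      rw [sub_mul, div_mul_cancel₀ _ ht]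
      congr 3 <;> rw [hc] <;> ring
  have hmain := lintegral_rearr_mul_le (f := fun s => f (vec s x)) (fun u => hf.le _)
    (by fun_prop) (fun u => hf.nonneg _) (fun τ hτ => hf.volume_fiber_ne_top x hτ.le)
    (Q := Q) (by fun_prop)
    (fun s t' h => ENNReal.ofReal_le_ofReal (abs_rpow_add_abs_rpow_le hp c t h)) s₀
  have hl : 2 * ∫⁻ s, ENNReal.ofReal (steiner f (vec s x)) * ENNReal.ofReal (|c + s * t| ^ p)
      = ∫⁻ s, ENNReal.ofReal (rearr (fun s => f (vec s x)) s) * Q s := by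
    have hev : ∫⁻ s, ENNReal.ofReal (steiner f (vec s x)) * ENNReal.ofReal (|c + s * t| ^ p)
        = ∫⁻ s, ENNReal.ofReal (steiner f (vec s x)) * ENNReal.ofReal (|c - s * t| ^ p) := by
      rw [← lintegral_neg_eq_self]
      refine lintegral_congr fun s => ?_
      rw [steiner_vec, steiner_vec, rearr_neg]
      congr 4
      ring
    rw [two_mul]
    nth_rw 2 [hev]
    rw [← lintegral_add_left (by fun_prop)]
    refine lintegral_congr fun s => ?_
    rw [steiner_vec, ← mul_add, hQ]
    simp only
    rw [ENNReal.ofReal_add (by positivity) (by positivity)]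
  rw [hl]
  refine hmain.trans ?_
  rw [← lintegral_add_left (by fun_prop)]
  refine lintegral_mono fun s => ?_
  simp only
  rw [← mul_add, ← ENNReal.ofReal_add (by positivity) (by positivity)]
  exact mul_le_mul_right (ENNReal.ofReal_le_ofReal (hs₀ s)) _

/-- Steiner symmetrization is compatible with moments at midpoints. -/
theorem two_mul_moment_steiner_le (hf : IsProfile B R f) (hp : 1 ≤ p) (t : ℝ) (y z : Fin d → ℝ) :
    2 * moment p (steiner f) (vec t ((1 / 2 : ℝ) • (y + z)))
      ≤ moment p f (vec t y) + moment p f (vec (-t) z) := by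
  have hp0 : 0 ≤ p := by linarith
  have h1 := hf.continuous.measurable
  have h2 := hf.steiner.continuous.measurable
  rw [← ENNReal.ofReal_le_ofReal_iff (add_nonneg (hf.moment_nonneg _ _) (hf.moment_nonneg _ _)),
    ENNReal.ofReal_mul (by norm_num), ENNReal.ofReal_add (hf.moment_nonneg _ _)
    (hf.moment_nonneg _ _), hf.ofReal_moment hp0, hf.ofReal_moment hp0,
    hf.steiner.ofReal_moment hp0]
  have hm : ∀ {g : EuclideanSpace ℝ (Fin (d + 1)) → ℝ} {y}, Measurable g →
      Measurable fun x => ENNReal.ofReal (g x) * ENNReal.ofReal (|⟪x, y⟫| ^ p) := by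
    intro g y hg
    fun_prop
  have hm' : ∀ {g : EuclideanSpace ℝ (Fin (d + 1)) → ℝ} {y : EuclideanSpace ℝ (Fin (d + 1))},
      Measurable g → Measurable fun x : Fin d → ℝ =>
        ∫⁻ s, ENNReal.ofReal (g (vec s x)) * ENNReal.ofReal (|⟪vec s x, y⟫| ^ p) := by
    intro g y hg
    have : Measurable fun q : (Fin d → ℝ) × ℝ =>
        ENNReal.ofReal (g (vec q.2 q.1)) * ENNReal.ofReal (|⟪vec q.2 q.1, y⟫| ^ p) := by
      have hv : Measurable fun q : (Fin d → ℝ) × ℝ => vec q.2 q.1 :=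
        continuous_vec.measurable.comp measurable_swap
      fun_prop
    exact this.lintegral_prod_right'
  rw [lintegral_vec (hm h1), lintegral_vec (hm h1), lintegral_vec (hm h2),
    ← lintegral_add_left (hm' h1), show ENNReal.ofReal 2 = 2 by simp,
    ← lintegral_const_mul _ (hm' h2)]
  refine lintegral_mono fun x => ?_
  simp only [inner_vec]
  have := two_mul_lintegral_fiber_steiner_le hf hp t x (x ⬝ᵥ y) (x ⬝ᵥ z)
  convert this using 8
  · simp [dotProduct_add]; ring
  · ring

/-- The integral of `exp (-moment p f)` over a ball. -/
noncomputable def expMoment {E : Type*} [NormedAddCommGroup E] [InnerProductSpace ℝ E]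
    [MeasureSpace E] (p r : ℝ) (f : E → ℝ) : ℝ≥0∞ :=
  ∫⁻ y in Metric.closedBall 0 r, ENNReal.ofReal (exp (-moment p f y))

theorem expMoment_le_expMoment_steiner (hf : IsProfile B R f) (hp : 1 ≤ p) (r : ℝ) :
    expMoment p r f ≤ expMoment p r (steiner f) := by
  have hp0 : 0 ≤ p := by linarith
  have hms := measurable_moment hf.continuous hp0
  have hms' := measurable_moment hf.steiner.continuous hp0
  have hb : MeasurableSet (Metric.closedBall (0 : EuclideanSpace ℝ (Fin (d + 1))) r) :=
    Metric.isClosed_closedBall.measurableSet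
  set F := fun g : EuclideanSpace ℝ (Fin (d + 1)) → ℝ =>
    (Metric.closedBall (0 : EuclideanSpace ℝ (Fin (d + 1))) r).indicator
      fun y => ENNReal.ofReal (exp (-moment p g y)) with hF
  have hm1 : Measurable (F f) := Measurable.indicator (by fun_prop) hb
  have hm2 : Measurable (F (steiner f)) := Measurable.indicator (by fun_prop) hb
  rw [expMoment, expMoment, ← lintegral_indicator hb, ← lintegral_indicator hb]
  change ∫⁻ y, F f y ≤ ∫⁻ y, F (steiner f) y
  rw [lintegral_vec' hm1, lintegral_vec' hm2]
  refine lintegral_mono fun t => ?_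
  have key := prekopa_leindler (u := fun y => F f (vec t y)) (v := fun z => F f (vec (-t) z))
    (w := fun y => F (steiner f) (vec t y)) (by fun_prop) (by fun_prop) (by fun_prop) ?_
  · have hneg : ∫⁻ z, F f (vec (-t) z) = ∫⁻ z, F f (vec t z) := by
      rw [← lintegral_neg_eq_self]
      refine lintegral_congr fun z => ?_
      have : vec (-t) (-z) = -vec t z := by
        ext i
        refine Fin.cases ?_ (fun j => ?_) i <;> simp
      rw [this, hF]
      simp only [indicator, moment_neg, Metric.mem_closedBall, dist_zero_right, norm_neg]
    rw [hneg, ← sq] at key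
    exact (ENNReal.pow_le_pow_left_iff two_ne_zero).1 key
  intro y z
  simp only [hF]
  by_cases hy : vec t y ∈ Metric.closedBall (0 : EuclideanSpace ℝ (Fin (d + 1))) r
  swap
  · simp [indicator_of_notMem hy]
  by_cases hz : vec (-t) z ∈ Metric.closedBall (0 : EuclideanSpace ℝ (Fin (d + 1))) r
  swap
  · simp [indicator_of_notMem hz]
  have hz' : vec t z ∈ Metric.closedBall (0 : EuclideanSpace ℝ (Fin (d + 1))) r := by
    simp only [Metric.mem_closedBall, dist_zero_right] at hz ⊢
    exact (norm_vec_le_norm_vec z (by simp)).trans hz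
  have hyz : vec t ((1 / 2 : ℝ) • (y + z)) ∈
      Metric.closedBall (0 : EuclideanSpace ℝ (Fin (d + 1))) r := by
    have := convex_closedBall (0 : EuclideanSpace ℝ (Fin (d + 1))) r hy hz'
      (by norm_num : (0 : ℝ) ≤ 1 / 2) (by norm_num : (0 : ℝ) ≤ 1 / 2) (by norm_num)
    convert this using 1
    ext i
    refine Fin.cases ?_ (fun j => ?_) i
    · simp only [vec_zero, PiLp.add_apply, PiLp.smul_apply, smul_eq_mul]; ring
    · simp
  rw [indicator_of_mem hy, indicator_of_mem hz, indicator_of_mem hyz,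
    ← ENNReal.ofReal_mul (exp_pos _).le, ← exp_add, ← ENNReal.ofReal_pow (exp_pos _).le,
    ← exp_nat_mul]
  refine ENNReal.ofReal_le_ofReal (exp_le_exp.2 ?_)
  have := two_mul_moment_steiner_le hf hp t y z
  push_cast
  linarith

end SteinerMoment

section Compactness

/-- Every modulus of continuity of `f` is a modulus of continuity of `g`. -/
def HasModulusOf {E : Type*} [PseudoMetricSpace E] (f g : E → ℝ) : Prop :=
  ∀ ε δ, (∀ x y, dist x y ≤ δ → |f x - f y| ≤ ε) → ∀ x y, dist x y ≤ δ → |g x - g y| ≤ ε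

theorem HasModulusOf.uniformContinuous {E : Type*} [PseudoMetricSpace E] {f g : E → ℝ}
    (h : HasModulusOf f g) (hf : UniformContinuous f) : UniformContinuous g := by
  refine Metric.uniformContinuous_iff_le.2 fun ε hε => ?_
  obtain ⟨δ, hδ, hfδ⟩ := Metric.uniformContinuous_iff_le.1 hf ε hε
  exact ⟨δ, hδ, fun x y hxy => h ε δ (fun x y h' => hfδ h') x y hxy⟩

/-- The functions sharing with `f` the profile bounds, the moduli of continuity, all the power
integrals, and for which `exp (-moment p ·)` has at least the same integral on the ball of radius
`r`. -/
structure Admissible {E : Type*} [NormedAddCommGroup E] [InnerProductSpace ℝ E] [MeasureSpace E]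
    (B R p r : ℝ) (f g : E → ℝ) : Prop where
  profile : IsProfile B R g
  modulus : HasModulusOf f g
  integral_rpow : ∀ s : ℝ, 0 < s → ∫ x, g x ^ s = ∫ x, f x ^ s
  le_integral_exp : ∫ y in Metric.closedBall 0 r, exp (-moment p f y)
    ≤ ∫ y in Metric.closedBall 0 r, exp (-moment p g y)

variable {E : Type*} [NormedAddCommGroup E] [InnerProductSpace ℝ E] [FiniteDimensional ℝ E]
  [MeasurableSpace E] [BorelSpace E] {B R p r : ℝ} {f g : E → ℝ}

omit [MeasurableSpace E] [BorelSpace E] in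
theorem isCompact_setOf_isProfile (hf : IsProfile B R f) :
    IsCompact {g : C(E, ℝ) | IsProfile B R g ∧ HasModulusOf f g} := by
  have hfu := hf.uniformContinuous
  refine ArzelaAscoli.isCompact_of_equicontinuous _ ?_ ?_
  · have : ContinuousMap.toFun '' {g : C(E, ℝ) | IsProfile B R g ∧ HasModulusOf f g}
        = {g : E → ℝ | (∀ x, g x ∈ Icc 0 B) ∧ (∀ x, R ≤ ‖x‖ → g x = 0) ∧ HasModulusOf f g} := by
      ext g
      constructor
      · rintro ⟨g, ⟨h1, h2⟩, rfl⟩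
        exact ⟨fun x => ⟨h1.nonneg x, h1.le x⟩, h1.zero, h2⟩
      · rintro ⟨h1, h2, h3⟩
        have hc := (h3.uniformContinuous hfu).continuous
        exact ⟨⟨g, hc⟩, ⟨⟨hc, fun x => (h1 x).1, fun x => (h1 x).2, h2⟩, h3⟩, rfl⟩
    rw [this]
    refine (isCompact_univ_pi fun _ : E => isCompact_Icc (a := (0 : ℝ)) (b := B)).of_isClosed_subset
      ?_ fun g hg x _ => hg.1 x
    simp only [HasModulusOf, ofPred_and, ofPred_forall]
    refine IsClosed.inter ?_ (IsClosed.inter ?_ ?_)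
    · exact isClosed_iInter fun x => isClosed_Icc.preimage (continuous_apply x)
    · exact isClosed_iInter fun x => isClosed_iInter fun _ =>
        isClosed_eq (continuous_apply x) continuous_const
    · refine isClosed_iInter fun ε => isClosed_iInter fun δ => isClosed_iInter fun _ =>
        isClosed_iInter fun x => isClosed_iInter fun y => isClosed_iInter fun _ => ?_
      exact isClosed_le ((continuous_apply x).sub (continuous_apply y)).abs continuous_const
  · refine UniformEquicontinuous.equicontinuous ?_
    refine Metric.uniformEquicontinuous_iff.2 fun ε hε => ?_
    obtain ⟨δ, hδ, hfδ⟩ := Metric.uniformContinuous_iff_le.1 hfu (ε / 2) (by positivity)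
    refine ⟨δ, hδ, fun x y hxy g => ?_⟩
    have := g.2.2 (ε / 2) δ (fun x y h' => hfδ h') x y hxy.le
    rw [Real.dist_eq]
    exact this.trans_lt (by linarith)

theorem continuousOn_integral_comp (R : ℝ) {G : ℝ → E → ℝ}
    (hG : Continuous fun q : ℝ × E => G q.1 q.2) (hG0 : ∀ x, G 0 x = 0) (B : ℝ)  :
    ContinuousOn (fun g : C(E, ℝ) => ∫ x, G (g x) x) {g | IsProfile B R g} := by
  obtain ⟨C, hC⟩ := ((isCompact_Icc (a := (0 : ℝ)) (b := B)).prod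
    (isCompact_closedBall (0 : E) R)).exists_bound_of_continuousOn hG.continuousOn
  refine continuousOn_of_dominated
    (bound := (Metric.closedBall (0 : E) R).indicator fun _ => C) ?_ ?_ ?_ ?_
  · intro g hg
    exact (hG.comp (g.continuous.prodMk continuous_id)).aestronglyMeasurable
  · intro g hg
    refine ae_of_all _ fun x => ?_
    by_cases hx : x ∈ Metric.closedBall (0 : E) R
    · rw [indicator_of_mem hx]
      exact hC (g x, x) ⟨⟨hg.nonneg x, hg.le x⟩, hx⟩
    · rw [indicator_of_notMem hx, hg.zero x (not_le.1 (by simpa using hx : ¬ ‖x‖ ≤ R)).le, hG0]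
      simp
  · exact (integrable_indicator_iff Metric.isClosed_closedBall.measurableSet).2
      (integrableOn_const measure_closedBall_lt_top.ne)
  · refine ae_of_all _ fun x => Continuous.continuousOn ?_
    exact hG.comp ((ContinuousEvalConst.continuous_eval_const x).prodMk continuous_const)

theorem exists_admissible_forall_le (hf : IsProfile B R f) (hp : 0 ≤ p) (r : ℝ) :
    ∃ g, Admissible B R p r f g ∧
      ∀ g', Admissible B R p r f g' → ∫ x, g x * ‖x‖ ≤ ∫ x, g' x * ‖x‖ := by
  set K₀ := {g : C(E, ℝ) | IsProfile B R g ∧ HasModulusOf f g} with hK₀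
  have hK₀c : IsCompact K₀ := isCompact_setOf_isProfile hf
  have hsub : K₀ ⊆ {g | IsProfile B R g} := fun g hg => hg.1
  have hmom : ∀ y, ContinuousOn (fun g : C(E, ℝ) => moment p g y) K₀ := fun y =>
    (continuousOn_integral_comp R (G := fun a x => a * |⟪x, y⟫| ^ p)
      (continuous_fst.mul
        ((continuous_snd.inner continuous_const).abs.rpow_const fun _ => Or.inr hp))
      (by simp) B).mono hsub
  have hexp : ContinuousOn
      (fun g : C(E, ℝ) => ∫ y in Metric.closedBall 0 r, exp (-moment p g y)) K₀ := by
    refine continuousOn_of_dominated (bound := fun _ => 1) ?_ ?_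
      (integrableOn_const measure_closedBall_lt_top.ne) ?_
    · intro g hg
      exact (measurable_moment g.continuous hp).neg.exp.aestronglyMeasurable
    · intro g hg
      refine ae_of_all _ fun y => ?_
      rw [Real.norm_eq_abs, abs_of_pos (exp_pos _), exp_le_one_iff]
      linarith [hg.1.moment_nonneg p y]
    · exact ae_of_all _ fun y => (hmom y).neg.rexp
  have hpow : ∀ s : ℝ, 0 < s → ContinuousOn (fun g : C(E, ℝ) => ∫ x, g x ^ s) K₀ := fun s hs =>
    (continuousOn_integral_comp R (G := fun a x => a ^ s)
      (continuous_fst.rpow_const fun _ => Or.inr hs.le) (by simp [hs.ne']) B).mono hsub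
  have hM : ContinuousOn (fun g : C(E, ℝ) => ∫ x, g x * ‖x‖) K₀ :=
    (continuousOn_integral_comp R (G := fun a x => a * ‖x‖) (by fun_prop) (by simp) B).mono hsub
  set K := {g : C(E, ℝ) | Admissible B R p r f g} with hK
  have hKc : IsCompact K := by
    have : K = (K₀ ∩ (fun g : C(E, ℝ) => ∫ y in Metric.closedBall 0 r, exp (-moment p g y)) ⁻¹'
        Ici (∫ y in Metric.closedBall 0 r, exp (-moment p f y))) ∩
        ⋂ s : Ioi (0 : ℝ), (K₀ ∩ (fun g : C(E, ℝ) => ∫ x, g x ^ (s : ℝ)) ⁻¹'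
          {∫ x, f x ^ (s : ℝ)}) := by
      ext g
      simp only [hK, hK₀, mem_inter_iff, mem_ofPred_eq, mem_preimage, mem_iInter, mem_Ici,
        mem_singleton_iff]
      constructor
      · rintro ⟨h1, h2, h3, h4⟩
        exact ⟨⟨⟨h1, h2⟩, h4⟩, fun s => ⟨⟨h1, h2⟩, h3 _ s.2⟩⟩
      · rintro ⟨⟨⟨h1, h2⟩, h4⟩, h5⟩
        exact ⟨h1, h2, fun s hs => (h5 ⟨s, hs⟩).2, h4⟩
    rw [this]
    refine (hK₀c.of_isClosed_subset (hexp.preimage_isClosed_of_isClosed hK₀c.isClosed isClosed_Ici)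
      inter_subset_left).inter_right (isClosed_iInter fun s => ?_)
    exact (hpow s s.2).preimage_isClosed_of_isClosed hK₀c.isClosed isClosed_singleton
  have hne : K.Nonempty := ⟨⟨f, hf.continuous⟩, hf, fun ε δ h => h, fun _ _ => rfl, le_rfl⟩
  obtain ⟨g, hg, hmin⟩ := hKc.exists_isMinOn hne (hM.mono fun g hg => ⟨hg.profile, hg.modulus⟩)
  exact ⟨g, hg, fun g' hg' => hmin (a := ⟨g', hg'.profile.continuous⟩) hg'⟩

theorem Admissible.comp_isometry (hg : Admissible B R p r f g) (ρ : E ≃ₗᵢ[ℝ] E) :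
    Admissible B R p r f (g ∘ ρ) := by
  have hρ := ρ.measurePreserving
  have hme := ρ.toHomeomorph.measurableEmbedding
  have hmom : ∀ y, moment p (g ∘ ρ) y = moment p g (ρ y) := by
    intro y
    rw [moment, moment, ← hρ.integral_comp hme fun x => g x * |⟪x, ρ y⟫| ^ p]
    simp
  refine ⟨⟨hg.profile.continuous.comp ρ.continuous, fun x => hg.profile.nonneg _,
    fun x => hg.profile.le _, fun x hx => hg.profile.zero _ (by simpa using hx)⟩,
    fun ε δ h x y hxy => hg.modulus ε δ h _ _ (by simpa using hxy), fun s hs => ?_, ?_⟩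
  · rw [← hg.integral_rpow s hs, ← hρ.integral_comp hme fun x => g x ^ s]
    rfl
  · refine hg.le_integral_exp.trans (le_of_eq ?_)
    rw [← hρ.setIntegral_preimage_emb hme]
    simp [hmom]

theorem integral_comp_mul_norm (g : E → ℝ) (ρ : E ≃ₗᵢ[ℝ] E) :
    ∫ x, (g ∘ ρ) x * ‖x‖ = ∫ x, g x * ‖x‖ := by
  rw [← ρ.measurePreserving.integral_comp ρ.toHomeomorph.measurableEmbedding fun x => g x * ‖x‖]
  simp

end Compactness

section Radial

variable {d : ℕ} {B R p r : ℝ} {f g : EuclideanSpace ℝ (Fin (d + 1)) → ℝ}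

theorem ofReal_integral_exp_neg_moment (hf : IsProfile B R f) (hp : 0 ≤ p) (r : ℝ) :
    ENNReal.ofReal (∫ y in Metric.closedBall 0 r, exp (-moment p f y)) = expMoment p r f := by
  refine ofReal_integral_eq_lintegral_ofReal ?_ (ae_of_all _ fun y => (exp_pos _).le)
  refine Integrable.mono' (g := fun _ => 1) (integrableOn_const measure_closedBall_lt_top.ne)
    (measurable_moment hf.continuous hp).neg.exp.aestronglyMeasurable (ae_of_all _ fun y => ?_)
  rw [Real.norm_eq_abs, abs_of_pos (exp_pos _), exp_le_one_iff]
  linarith [hf.moment_nonneg p y]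

theorem Admissible.steiner (hg : Admissible B R p r f g) (hp : 1 ≤ p) :
    Admissible B R p r f (steiner g) := by
  have hp0 : 0 ≤ p := by linarith
  refine ⟨hg.profile.steiner, fun ε δ h => ?_, fun s hs => ?_, hg.le_integral_exp.trans ?_⟩
  · exact abs_steiner_sub_le hg.profile.continuous hg.profile.le (hg.modulus ε δ h)
  · rw [← hg.integral_rpow s hs,
      integral_eq_lintegral_of_nonneg_ae
        (ae_of_all _ fun x => rpow_nonneg (hg.profile.steiner.nonneg x) _)
        (hg.profile.steiner.continuous.rpow_const fun _ => Or.inr hs.le).aestronglyMeasurable,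
      integral_eq_lintegral_of_nonneg_ae
        (ae_of_all _ fun x => rpow_nonneg (hg.profile.nonneg x) _)
        (hg.profile.continuous.rpow_const fun _ => Or.inr hs.le).aestronglyMeasurable,
      lintegral_steiner_rpow hg.profile hs]
  · rw [← ENNReal.ofReal_le_ofReal_iff (integral_nonneg fun _ => (exp_pos _).le),
      ofReal_integral_exp_neg_moment hg.profile hp0,
      ofReal_integral_exp_neg_moment hg.profile.steiner hp0]
    exact expMoment_le_expMoment_steiner hg.profile hp r

theorem IsProfile.ofReal_integral_mul_norm (hf : IsProfile B R f) :
    ENNReal.ofReal (∫ x, f x * ‖x‖) = ∫⁻ x, ENNReal.ofReal (f x) * ENNReal.ofReal ‖x‖ := by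
  rw [ofReal_integral_eq_lintegral_ofReal (hf.integrable_mul continuous_norm)
    (ae_of_all _ fun x => mul_nonneg (hf.nonneg x) (norm_nonneg _))]
  exact lintegral_congr fun x => ENNReal.ofReal_mul (hf.nonneg x)

/-- A function which is even in the first coordinate in every orthonormal frame is radial. -/
theorem eq_of_norm_eq_of_forall_even
    (h : ∀ (ρ : EuclideanSpace ℝ (Fin (d + 1)) ≃ₗᵢ[ℝ] EuclideanSpace ℝ (Fin (d + 1))) s x,
      g (ρ (vec (-s) x)) = g (ρ (vec s x))) {x y : EuclideanSpace ℝ (Fin (d + 1))}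
    (hxy : ‖x‖ = ‖y‖) : g x = g y := by
  by_cases hne : x = y
  · rw [hne]
  have hsub : 0 < ‖x - y‖ := norm_pos_iff.2 (sub_ne_zero.2 hne)
  set u : EuclideanSpace ℝ (Fin (d + 1)) := ‖x - y‖⁻¹ • (x - y) with hu
  set e : EuclideanSpace ℝ (Fin (d + 1)) := EuclideanSpace.single 0 1 with he
  have hun : ‖u‖ = ‖e‖ := by
    rw [hu, norm_smul, norm_inv, norm_norm, inv_mul_cancel₀ hsub.ne', he]
    simp
  set ρ := Submodule.reflection (ℝ ∙ (u - e))ᗮ with hρ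
  have hρu : ρ u = e := Submodule.reflection_sub hun
  have hρe : ρ e = u := by rw [← hρu]; exact Submodule.reflection_reflection _ _
  have hρρ : ∀ z, ρ (ρ z) = z := Submodule.reflection_reflection _
  have hxy' : x - y = ‖x - y‖ • u := by
    rw [hu, smul_smul, mul_inv_cancel₀ hsub.ne', one_smul]
  have h1 : ρ x - ρ y = ‖x - y‖ • e := by
    rw [← map_sub, hxy', map_smul, hρu, ← hxy']
  have htail : tail (ρ x) = tail (ρ y) := by
    ext i
    have := congrArg (fun z : EuclideanSpace ℝ (Fin (d + 1)) => z i.succ) h1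
    simp [he] at this
    simp only [tail]
    linarith
  have hnorm : ‖ρ x‖ = ‖ρ y‖ := by simpa using hxy
  have hsq : (ρ x) 0 ^ 2 = (ρ y) 0 ^ 2 := by
    have h2 : ‖ρ x‖ ^ 2 = ‖ρ y‖ ^ 2 := by rw [hnorm]
    rw [← vec_tail (ρ x), ← vec_tail (ρ y), norm_vec_sq, norm_vec_sq, htail] at h2
    simpa using h2
  have h2 := h ρ ((ρ y) 0) (tail (ρ y))
  rcases sq_eq_sq_iff_eq_or_eq_neg.1 hsq with h3 | h3
  · have : ρ x = ρ y := by rw [← vec_tail (ρ x), ← vec_tail (ρ y), h3, htail]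
    exact absurd (ρ.injective this) hne
  · rw [← h3, ← htail, vec_tail, htail, vec_tail, hρρ, hρρ] at h2
    exact h2

/-- Among the admissible functions there is a radial one. -/
theorem exists_admissible_radial (hf : IsProfile B R f) (hp : 1 ≤ p) (r : ℝ) :
    ∃ g, Admissible B R p r f g ∧ ∀ x y, ‖x‖ = ‖y‖ → g x = g y := by
  obtain ⟨g, hg, hmin⟩ := exists_admissible_forall_le hf (by linarith) r
  refine ⟨g, hg, fun x y hxy => eq_of_norm_eq_of_forall_even (fun ρ s x => ?_) hxy⟩
  have hgρ := hg.comp_isometry ρ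
  have hS := hgρ.steiner hp
  have hle := hmin _ hS
  rw [← integral_comp_mul_norm g ρ] at hle
  refine even_of_lintegral_le_steiner hgρ.profile ?_ ?_ s x
  · rw [← hgρ.profile.ofReal_integral_mul_norm, ← hS.profile.ofReal_integral_mul_norm]
    exact ENNReal.ofReal_le_ofReal hle
  · rw [← hS.profile.ofReal_integral_mul_norm]
    exact ENNReal.ofReal_ne_top

end Radial

section Polar

variable {E : Type*} [NormedAddCommGroup E] [InnerProductSpace ℝ E] [FiniteDimensional ℝ E]
  [MeasurableSpace E] [BorelSpace E] [Nontrivial E]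

/-- Integration in polar coordinates. -/
theorem lintegral_eq_lintegral_toSphere {F : E → ℝ≥0∞} (hF : Measurable F) :
    ∫⁻ x, F x = ∫⁻ ξ : Metric.sphere (0 : E) 1, (∫⁻ r in Ioi (0 : ℝ),
      ENNReal.ofReal (r ^ (Module.finrank ℝ E - 1)) * F (r • (ξ : E)))
        ∂(volume : Measure E).toSphere := by
  have h1 := (volume : Measure E).measurePreserving_homeomorphUnitSphereProd.symm
    (homeomorphUnitSphereProd E).toMeasurableEquiv
  have hcomp := h1.lintegral_comp_emb (MeasurableEquiv.measurableEmbedding _)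
    fun x : ({0}ᶜ : Set E) => F x
  rw [lintegral_subtype_comap (measurableSet_singleton (0 : E)).compl F,
    restrict_compl_singleton] at hcomp
  have hm : Measurable fun q : Metric.sphere (0 : E) 1 × Ioi (0 : ℝ) =>
      F ((q.2 : ℝ) • (q.1 : E)) := hF.comp (by fun_prop)
  have hm1 : ∀ ξ : Metric.sphere (0 : E) 1, Measurable fun r : Ioi (0 : ℝ) => F ((r : ℝ) • (ξ : E)) :=
    fun ξ => hF.comp (by fun_prop)
  rw [← hcomp]
  change ∫⁻ q : Metric.sphere (0 : E) 1 × Ioi (0 : ℝ), F ((q.2 : ℝ) • (q.1 : E)) ∂_ = _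
  rw [lintegral_prod _ hm.aemeasurable]
  refine lintegral_congr fun ξ => ?_
  rw [Measure.volumeIoiPow, lintegral_withDensity_eq_lintegral_mul _ (by fun_prop) (hm1 ξ),
    ← lintegral_subtype_comap measurableSet_Ioi]
  rfl

theorem lintegral_Ioi_pow_mul_exp {n : ℕ} (hn : 1 ≤ n) {q s h : ℝ} (hq : 0 ≤ q) (hs : 0 < s)
    (hh : 0 < h) :
    ∫⁻ r in Ioi (0 : ℝ), ENNReal.ofReal (r ^ (n - 1)) * ENNReal.ofReal (r ^ q * exp (-h * r ^ s))
      = ENNReal.ofReal (h ^ (-(q + n) / s) * (1 / s) * Gamma ((q + n) / s)) := by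
  have hn' : (1 : ℝ) ≤ n := by exact_mod_cast hn
  have hq' : -1 < q + n - 1 := by linarith
  have := integral_rpow_mul_exp_neg_mul_rpow hs hq' hh
  rw [sub_add_cancel] at this
  rw [← this, ofReal_integral_eq_lintegral_ofReal
    (integrableOn_rpow_mul_exp_neg_mul_rpow hq' hs hh)]
  · refine setLIntegral_congr_fun measurableSet_Ioi fun r hr => ?_
    have hr : 0 < r := hr
    rw [← ENNReal.ofReal_mul (by positivity), ← mul_assoc]
    congr 2
    rw [← rpow_natCast, ← rpow_add hr, Nat.cast_sub hn]
    congr 1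
    push_cast
    ring
  · filter_upwards [ae_restrict_mem measurableSet_Ioi] with r hr
    have hr : 0 < r := hr
    positivity

theorem lintegral_norm_rpow_mul_exp {q s h : ℝ} (hq : 0 ≤ q) (hs : 0 < s) (hh : 0 < h) :
    ∫⁻ x : E, ENNReal.ofReal (‖x‖ ^ q * exp (-h * ‖x‖ ^ s))
      = ENNReal.ofReal (Module.finrank ℝ E * volume.real (Metric.ball (0 : E) 1) *
        (h ^ (-(q + Module.finrank ℝ E) / s) * (1 / s) *
          Gamma ((q + Module.finrank ℝ E) / s))) := by
  rw [lintegral_eq_lintegral_toSphere (by fun_prop)]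
  have : ∀ ξ : Metric.sphere (0 : E) 1, ∫⁻ r in Ioi (0 : ℝ),
      ENNReal.ofReal (r ^ (Module.finrank ℝ E - 1)) *
        ENNReal.ofReal (‖r • (ξ : E)‖ ^ q * exp (-h * ‖r • (ξ : E)‖ ^ s))
      = ENNReal.ofReal (h ^ (-(q + Module.finrank ℝ E) / s) * (1 / s) *
          Gamma ((q + Module.finrank ℝ E) / s)) := by
    intro ξ
    rw [← lintegral_Ioi_pow_mul_exp Module.finrank_pos hq hs hh]
    refine setLIntegral_congr_fun measurableSet_Ioi fun r hr => ?_
    have hr : 0 < r := hr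
    simp [norm_smul, abs_of_pos hr]
  rw [lintegral_congr this, lintegral_const, ← Measure.toSphere_real_apply_univ,
    ENNReal.ofReal_mul measureReal_nonneg, Measure.real,
    ENNReal.ofReal_toReal (measure_ne_top _ _), mul_comm]

theorem lintegral_exp_neg_mul_norm_rpow {s h : ℝ} (hs : 0 < s) (hh : 0 < h) :
    ∫⁻ x : E, ENNReal.ofReal (exp (-h * ‖x‖ ^ s))
      = ENNReal.ofReal (Module.finrank ℝ E * volume.real (Metric.ball (0 : E) 1) *
        (h ^ (-(Module.finrank ℝ E : ℝ) / s) * (1 / s) * Gamma (Module.finrank ℝ E / s))) := by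
  simpa using lintegral_norm_rpow_mul_exp (E := E) le_rfl hs hh

/-- The integral of `(1 + β ‖x‖ ^ p) ^ (-μ)`. -/
theorem lintegral_one_add_norm_rpow_rpow_neg {p μ β : ℝ} (hp : 0 < p) (hβ : 0 < β)
    (hμ : (Module.finrank ℝ E : ℝ) / p < μ) :
    ∫⁻ x : E, ENNReal.ofReal ((1 + β * ‖x‖ ^ p) ^ (-μ))
      = ENNReal.ofReal (Module.finrank ℝ E * volume.real (Metric.ball (0 : E) 1) / p *
        β ^ (-(Module.finrank ℝ E : ℝ) / p) * (Gamma (Module.finrank ℝ E / p) *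
          Gamma (μ - Module.finrank ℝ E / p) / Gamma μ)) := by
  set n : ℝ := (Module.finrank ℝ E : ℝ) with hn
  have hn0 : 0 < n := by rw [hn]; exact_mod_cast Module.finrank_pos
  set ω := volume.real (Metric.ball (0 : E) 1)
  have hω : 0 ≤ ω := measureReal_nonneg
  have hμ0 : 0 < μ := lt_trans (by positivity) hμ
  have hΓ : 0 < Gamma μ := Gamma_pos_of_pos hμ0
  have hΓ' : 0 < Gamma (n / p) := Gamma_pos_of_pos (by positivity)
  have h1 : ∀ x : E, ENNReal.ofReal ((1 + β * ‖x‖ ^ p) ^ (-μ)) = ENNReal.ofReal (Gamma μ)⁻¹ *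
      ∫⁻ t in Ioi (0 : ℝ), ENNReal.ofReal (t ^ (μ - 1) * exp (-t)) *
        ENNReal.ofReal (exp (-(t * β) * ‖x‖ ^ p)) := by
    intro x
    have hpos : 0 < 1 + β * ‖x‖ ^ p := by positivity
    have h2 := integral_rpow_mul_exp_neg_mul_rpow (p := 1) one_pos (q := μ - 1) (by linarith) hpos
    have h3 : ∫⁻ t in Ioi (0 : ℝ), ENNReal.ofReal (t ^ (μ - 1) * exp (-t)) *
        ENNReal.ofReal (exp (-(t * β) * ‖x‖ ^ p))
        = ENNReal.ofReal ((1 + β * ‖x‖ ^ p) ^ (-μ) * Gamma μ) := by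
      simp only [sub_add_cancel, div_one, mul_one, rpow_one] at h2
      rw [← h2, ofReal_integral_eq_lintegral_ofReal]
      · refine setLIntegral_congr_fun measurableSet_Ioi fun t ht => ?_
        have ht : 0 < t := ht
        rw [← ENNReal.ofReal_mul (by positivity), mul_assoc, ← exp_add]
        congr 3
        ring
      · have := integrableOn_rpow_mul_exp_neg_mul_rpow (p := 1) (s := μ - 1) (by linarith)
          one_pos hpos
        simp only [rpow_one] at this
        exact this
      · filter_upwards [ae_restrict_mem measurableSet_Ioi] with t ht
        have ht : 0 < t := ht
        positivity
    rw [h3, ← ENNReal.ofReal_mul (by positivity)]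
    congr 1
    field_simp
  simp_rw [h1]
  rw [lintegral_const_mul' _ _ ENNReal.ofReal_ne_top,
    lintegral_lintegral_swap (by fun_prop)]
  have h2 : ∀ t ∈ Ioi (0 : ℝ), ∫⁻ x : E, ENNReal.ofReal (t ^ (μ - 1) * exp (-t)) *
        ENNReal.ofReal (exp (-(t * β) * ‖x‖ ^ p))
      = ENNReal.ofReal (n * ω / p * β ^ (-n / p) * Gamma (n / p) *
          (exp (-t) * t ^ (μ - n / p - 1))) := by
    intro t ht
    have ht : 0 < t := ht
    rw [lintegral_const_mul' _ _ ENNReal.ofReal_ne_top,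
      lintegral_exp_neg_mul_norm_rpow hp (by positivity), ← ENNReal.ofReal_mul (by positivity)]
    congr 1
    rw [mul_rpow ht.le hβ.le, show μ - n / p - 1 = (μ - 1) + (-n / p) by ring, rpow_add ht]
    ring
  rw [setLIntegral_congr_fun measurableSet_Ioi h2]
  have h3 : ∫⁻ t in Ioi (0 : ℝ), ENNReal.ofReal (exp (-t) * t ^ (μ - n / p - 1))
      = ENNReal.ofReal (Gamma (μ - n / p)) := by
    rw [Gamma_eq_integral (by linarith), ofReal_integral_eq_lintegral_ofReal]
    · exact GammaIntegral_convergent (by linarith)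
    · filter_upwards [ae_restrict_mem measurableSet_Ioi] with t ht
      have ht : 0 < t := ht
      positivity
  have hc : 0 ≤ n * ω / p * β ^ (-n / p) * Gamma (n / p) := by positivity
  simp_rw [ENNReal.ofReal_mul hc]
  rw [lintegral_const_mul' _ _ ENNReal.ofReal_ne_top, h3, ← ENNReal.ofReal_mul hc,
    ← ENNReal.ofReal_mul (by positivity)]
  congr 1
  field_simp

end Polar

section RadialMoment

variable {E : Type*} [NormedAddCommGroup E] [InnerProductSpace ℝ E] [FiniteDimensional ℝ E]
  [MeasurableSpace E] [BorelSpace E] {B R p : ℝ}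

/-- The absolute moments of a radial weight are proportional to powers of the norm. -/
theorem lintegral_radial_mul_abs_inner_rpow {w : E → ℝ≥0∞}
    (hw : ∀ x y, ‖x‖ = ‖y‖ → w x = w y) {e : E} (he : ‖e‖ = 1) (y : E) :
    ∫⁻ x, w x * ENNReal.ofReal (|⟪x, y⟫| ^ p)
      = ENNReal.ofReal (‖y‖ ^ p) * ∫⁻ x, w x * ENNReal.ofReal (|⟪x, e⟫| ^ p) := by
  set ρ := Submodule.reflection (ℝ ∙ (y - ‖y‖ • e))ᗮ with hρ
  have hρy : ρ y = ‖y‖ • e := Submodule.reflection_sub (by rw [norm_smul, he]; simp)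
  rw [← lintegral_const_mul' _ _ ENNReal.ofReal_ne_top,
    ← ρ.measurePreserving.lintegral_comp_emb ρ.toHomeomorph.measurableEmbedding]
  refine lintegral_congr fun x => ?_
  rw [hw (ρ x) x (by simp)]
  have : ⟪ρ x, y⟫ = ‖y‖ * ⟪x, e⟫ := by
    rw [← ρ.inner_map_map, hρy, inner_smul_right, hρ, Submodule.reflection_reflection]
  rw [this, abs_mul, abs_norm, mul_rpow (norm_nonneg _) (abs_nonneg _),
    ENNReal.ofReal_mul (by positivity)]
  ring

theorem lintegral_radial_moment_mul {v w : E → ℝ≥0∞} (hvm : Measurable v) (hwm : Measurable w)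
    (hv : ∀ x y, ‖x‖ = ‖y‖ → v x = v y) (hw : ∀ x y, ‖x‖ = ‖y‖ → w x = w y) {e : E}
    (he : ‖e‖ = 1) :
    (∫⁻ x, v x * ENNReal.ofReal (|⟪x, e⟫| ^ p)) * ∫⁻ y, w y * ENNReal.ofReal (‖y‖ ^ p)
      = (∫⁻ y, w y * ENNReal.ofReal (|⟪y, e⟫| ^ p)) * ∫⁻ x, v x * ENNReal.ofReal (‖x‖ ^ p) := by
  have h1 : ∀ {v w : E → ℝ≥0∞}, Measurable v → Measurable w →
      (∀ x y, ‖x‖ = ‖y‖ → v x = v y) →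
      (∫⁻ x, v x * ENNReal.ofReal (|⟪x, e⟫| ^ p)) * ∫⁻ y, w y * ENNReal.ofReal (‖y‖ ^ p)
      = ∫⁻ y, ∫⁻ x, w y * v x * ENNReal.ofReal (|⟪x, y⟫| ^ p) := by
    intro v w hvm hwm hv
    rw [← lintegral_const_mul _ (by fun_prop)]
    refine lintegral_congr fun y => ?_
    simp_rw [mul_assoc]
    rw [lintegral_const_mul _ (by fun_prop), lintegral_radial_mul_abs_inner_rpow hv he y]
    ring
  rw [h1 hvm hwm hv, h1 hwm hvm hw, lintegral_lintegral_swap]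
  · refine lintegral_congr fun x => lintegral_congr fun y => ?_
    rw [real_inner_comm, mul_comm (w y)]
  · fun_prop

end RadialMoment

section GaussianMoment

variable {d : ℕ} {B R p : ℝ}

theorem lintegral_exp_neg_dotProduct (d : ℕ) :
    ∫⁻ x : Fin d → ℝ, ENNReal.ofReal (exp (-(x ⬝ᵥ x))) = ENNReal.ofReal (π ^ ((d : ℝ) / 2)) := by
  have h1 := GaussianFourier.integral_rexp_neg_mul_sq_norm (V := EuclideanSpace ℝ (Fin d)) one_pos
  have hint : Integrable fun v : EuclideanSpace ℝ (Fin d) => exp (-1 * ‖v‖ ^ 2) := by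
    refine by_contra fun h => ?_
    rw [integral_undef h] at h1
    have : 0 < (π / 1) ^ ((Module.finrank ℝ (EuclideanSpace ℝ (Fin d)) : ℝ) / 2) := by positivity
    exact this.ne h1
  rw [finrank_euclideanSpace_fin, div_one] at h1
  rw [← h1, ofReal_integral_eq_lintegral_ofReal hint (ae_of_all _ fun _ => (exp_pos _).le),
    ← (PiLp.volume_preserving_toLp (Fin d)).lintegral_comp (by fun_prop)]
  refine lintegral_congr fun x => ?_
  rw [EuclideanSpace.norm_sq_eq]
  simp [dotProduct, sq]

theorem lintegral_abs_rpow_mul_exp_neg_sq (hp : 0 ≤ p) :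
    ∫⁻ s : ℝ, ENNReal.ofReal (|s| ^ p * exp (-s ^ 2)) = ENNReal.ofReal (Gamma ((p + 1) / 2)) := by
  have := lintegral_norm_rpow_mul_exp (E := ℝ) hp two_pos one_pos
  simp only [Real.norm_eq_abs, Module.finrank_self, Measure.real, Real.volume_ball] at this
  convert this using 1
  · refine lintegral_congr fun s => ?_
    simp
  · simp

theorem lintegral_gaussian_mul_abs_rpow (hp : 0 ≤ p) :
    ∫⁻ y : EuclideanSpace ℝ (Fin (d + 1)), ENNReal.ofReal (exp (-1 * ‖y‖ ^ (2 : ℝ))) *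
        ENNReal.ofReal (|⟪y, EuclideanSpace.single 0 1⟫| ^ p)
      = ENNReal.ofReal (π ^ ((d : ℝ) / 2) * Gamma ((p + 1) / 2)) := by
  rw [lintegral_vec' (by fun_prop), ENNReal.ofReal_mul (by positivity),
    ← lintegral_exp_neg_dotProduct, ← lintegral_abs_rpow_mul_exp_neg_sq hp,
    ← lintegral_const_mul _ (by fun_prop)]
  refine lintegral_congr fun s => ?_
  rw [← lintegral_mul_const _ (by unfold dotProduct; fun_prop)]
  refine lintegral_congr fun x => ?_
  rw [← ENNReal.ofReal_mul (by positivity), ← ENNReal.ofReal_mul (by positivity)]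
  congr 1
  have : ⟪vec s x, EuclideanSpace.single 0 1⟫ = s := by
    simp [PiLp.inner_apply]
  rw [this, rpow_two, norm_vec_sq, show -1 * (x ⬝ᵥ x + s ^ 2) = -(x ⬝ᵥ x) + -s ^ 2 by ring,
    exp_add]
  ring

theorem moment_eq_of_radial {g : EuclideanSpace ℝ (Fin (d + 1)) → ℝ} (hg : IsProfile B R g)
    (hp : 0 ≤ p) (hrad : ∀ x y, ‖x‖ = ‖y‖ → g x = g y) (y : EuclideanSpace ℝ (Fin (d + 1))) :
    moment p g y = 2 * π ^ ((d : ℝ) / 2) * Gamma ((p + 1) / 2) /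
      ((d + 1) * volume.real (Metric.ball (0 : EuclideanSpace ℝ (Fin (d + 1))) 1) *
        Gamma ((p + (d + 1)) / 2)) * (∫ x, g x * ‖x‖ ^ p) * ‖y‖ ^ p := by
  set e : EuclideanSpace ℝ (Fin (d + 1)) := EuclideanSpace.single 0 1 with he
  have hen : ‖e‖ = 1 := by simp [he]
  have hradw : ∀ x y, ‖x‖ = ‖y‖ → ENNReal.ofReal (g x) = ENNReal.ofReal (g y) :=
    fun x y h => by rw [hrad x y h]
  set m := ∫ x, g x * ‖x‖ ^ p with hm
  have hm0 : 0 ≤ m := integral_nonneg fun x => mul_nonneg (hg.nonneg x) (by positivity)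
  have hmlin : ∫⁻ x, ENNReal.ofReal (g x) * ENNReal.ofReal (‖x‖ ^ p) = ENNReal.ofReal m := by
    rw [hm, ofReal_integral_eq_lintegral_ofReal
      (hg.integrable_mul (continuous_norm.rpow_const fun _ => Or.inr hp))
      (ae_of_all _ fun x => mul_nonneg (hg.nonneg x) (by positivity))]
    exact lintegral_congr fun x => (ENNReal.ofReal_mul (hg.nonneg x)).symm
  set ω := volume.real (Metric.ball (0 : EuclideanSpace ℝ (Fin (d + 1))) 1) with hω
  have hω0 : 0 < ω := ENNReal.toReal_pos (Metric.measure_ball_pos _ _ one_pos).ne'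
    measure_ball_lt_top.ne
  have hΓ : 0 < Gamma ((p + (d + 1)) / 2) := Gamma_pos_of_pos (by positivity)
  have hΓ1 : 0 < Gamma ((p + 1) / 2) := Gamma_pos_of_pos (by positivity)
  have h1 := lintegral_radial_moment_mul (p := p) (v := fun x => ENNReal.ofReal (g x))
    (w := fun y => ENNReal.ofReal (exp (-1 * ‖y‖ ^ (2 : ℝ))))
    hg.continuous.measurable.ennreal_ofReal (by fun_prop) hradw (fun x y h => by rw [h]) hen
  have h2 : ∫⁻ y : EuclideanSpace ℝ (Fin (d + 1)), ENNReal.ofReal (exp (-1 * ‖y‖ ^ (2 : ℝ))) *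
      ENNReal.ofReal (‖y‖ ^ p)
      = ENNReal.ofReal ((d + 1) * ω * (1 / 2 * Gamma ((p + (d + 1)) / 2))) := by
    have := lintegral_norm_rpow_mul_exp (E := EuclideanSpace ℝ (Fin (d + 1))) hp two_pos one_pos
    rw [finrank_euclideanSpace_fin, one_rpow, one_mul] at this
    push_cast at this
    rw [← hω] at this
    rw [← this]
    refine lintegral_congr fun y => ?_
    rw [← ENNReal.ofReal_mul (exp_pos _).le, mul_comm]
  rw [h2, hmlin, lintegral_gaussian_mul_abs_rpow hp, ← hg.ofReal_moment hp,
    ← ENNReal.ofReal_mul (hg.moment_nonneg _ _), ← ENNReal.ofReal_mul (by positivity),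
    ENNReal.ofReal_eq_ofReal_iff (mul_nonneg (hg.moment_nonneg _ _) (by positivity))
    (by positivity)] at h1
  have h3 := lintegral_radial_mul_abs_inner_rpow (p := p) hradw hen y
  rw [← hg.ofReal_moment hp, ← hg.ofReal_moment hp, ← ENNReal.ofReal_mul (by positivity),
    ENNReal.ofReal_eq_ofReal_iff (hg.moment_nonneg _ _)
    (mul_nonneg (by positivity) (hg.moment_nonneg _ _))] at h3
  rw [h3]
  have h4 : moment p g e = 2 * π ^ ((d : ℝ) / 2) * Gamma ((p + 1) / 2) /
      ((d + 1) * ω * Gamma ((p + (d + 1)) / 2)) * m := by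
    field_simp
    linear_combination 2 * h1
  rw [h4]
  ring

end GaussianMoment

section Hoelder

variable {E : Type*} [NormedAddCommGroup E] [InnerProductSpace ℝ E] [FiniteDimensional ℝ E]
  [MeasurableSpace E] [BorelSpace E] [Nontrivial E] {B R p : ℝ} {g : E → ℝ}

theorem IsProfile.integral_rpow_le (hg : IsProfile B R g) (hp : 0 < p) {lam β : ℝ}
    (hlam0 : 0 < lam) (hlam1 : lam < 1) (hβ : 0 < β)
    (hlam : (Module.finrank ℝ E : ℝ) / p < lam / (1 - lam)) :
    ∫ x, g x ^ lam ≤ ((∫ x, g x) + β * ∫ x, g x * ‖x‖ ^ p) ^ lam *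
      (Module.finrank ℝ E * volume.real (Metric.ball (0 : E) 1) / p *
        β ^ (-(Module.finrank ℝ E : ℝ) / p) * (Gamma (Module.finrank ℝ E / p) *
          Gamma (lam / (1 - lam) - Module.finrank ℝ E / p) / Gamma (lam / (1 - lam)))) ^
            (1 - lam) := by
  set μ := lam / (1 - lam) with hμ
  have hl : 0 < 1 - lam := by linarith
  have hμ0 : 0 < μ := by positivity
  have hcn : Continuous fun x : E => ‖x‖ ^ p := continuous_norm.rpow_const fun _ => Or.inr hp.le
  have hgm := hg.continuous.measurable
  have hN : ∫ x, g x * (1 + β * ‖x‖ ^ p) = (∫ x, g x) + β * ∫ x, g x * ‖x‖ ^ p := by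
    rw [← integral_const_mul, ← integral_add]
    · exact integral_congr_ae (ae_of_all _ fun x => by ring)
    · simpa using hg.integrable_mul (g := fun _ => 1) continuous_const
    · exact (hg.integrable_mul hcn).const_mul _
  have hN0 : 0 ≤ (∫ x, g x) + β * ∫ x, g x * ‖x‖ ^ p := by
    rw [← hN]
    exact integral_nonneg fun x => mul_nonneg (hg.nonneg x) (by positivity)
  have hNl : ∫⁻ x, ENNReal.ofReal (g x * (1 + β * ‖x‖ ^ p))
      = ENNReal.ofReal ((∫ x, g x) + β * ∫ x, g x * ‖x‖ ^ p) := by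
    rw [← hN, ofReal_integral_eq_lintegral_ofReal (hg.integrable_mul (by fun_prop))
      (ae_of_all _ fun x => mul_nonneg (hg.nonneg x) (by positivity))]
  have hJ := lintegral_one_add_norm_rpow_rpow_neg (E := E) hp hβ hlam
  have hH := ENNReal.lintegral_mul_norm_pow_le (μ := (volume : Measure E))
    (f := fun x => ENNReal.ofReal (g x * (1 + β * ‖x‖ ^ p)))
    (g := fun x => ENNReal.ofReal ((1 + β * ‖x‖ ^ p) ^ (-μ)))
    (by fun_prop) (by fun_prop) hlam0.le hl.le (by ring)
  have hJ0 : 0 ≤ Module.finrank ℝ E * volume.real (Metric.ball (0 : E) 1) / p *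
        β ^ (-(Module.finrank ℝ E : ℝ) / p) * (Gamma (Module.finrank ℝ E / p) *
          Gamma (μ - Module.finrank ℝ E / p) / Gamma μ) := by
    have h1 : 0 < Gamma (μ - Module.finrank ℝ E / p) := Gamma_pos_of_pos (by linarith)
    have h2 : 0 < Gamma μ := Gamma_pos_of_pos hμ0
    have h3 : 0 < Gamma (Module.finrank ℝ E / p) := Gamma_pos_of_pos
      (div_pos (by exact_mod_cast Module.finrank_pos) hp)
    have := measureReal_nonneg (μ := (volume : Measure E)) (s := Metric.ball (0 : E) 1)
    positivity
  rw [hNl, hJ, ENNReal.ofReal_rpow_of_nonneg hN0 hlam0.le, ENNReal.ofReal_rpow_of_nonneg hJ0 hl.le,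
    ← ENNReal.ofReal_mul (by positivity)] at hH
  rw [integral_eq_lintegral_of_nonneg_ae (ae_of_all _ fun x => rpow_nonneg (hg.nonneg x) _)
    (hg.continuous.rpow_const fun _ => Or.inr hlam0.le).aestronglyMeasurable]
  refine ENNReal.toReal_le_of_le_ofReal (by positivity) (le_trans (le_of_eq ?_) hH)
  refine lintegral_congr fun x => ?_
  have h1 : 0 < 1 + β * ‖x‖ ^ p := by positivity
  have h2 := hg.nonneg x
  rw [ENNReal.ofReal_rpow_of_nonneg (by positivity) hlam0.le,
    ENNReal.ofReal_rpow_of_nonneg (by positivity) hl.le, ← ENNReal.ofReal_mul (by positivity),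
    mul_rpow h2 h1.le, ← rpow_mul h1.le, mul_assoc, ← rpow_add h1]
  congr 1
  rw [show lam + -μ * (1 - lam) = 0 by rw [hμ]; field_simp; ring]
  simp

end Hoelder

section Radial

theorem rpow_neg_le_of_le_mul_rpow {N L m J x a lam : ℝ} (hN : 0 < N) (hL : 0 < L) (hm : 0 < m)
    (hJ : 0 < J) (hx : 0 < x) (hlam1 : lam < 1)
    (h : L ≤ (N + x * N / m * m) ^ lam * (J * (x * N / m) ^ (-a)) ^ (1 - lam)) :
    m ^ (-a) ≤ L ^ (-(1 / (1 - lam))) * (N ^ (lam / (1 - lam) - a) * (1 + x) ^ (lam / (1 - lam)) *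
      x ^ (-a) * J) := by
  have hl : 0 < 1 - lam := by linarith
  have h1 := rpow_le_rpow hL.le h (z := 1 / (1 - lam)) (by positivity)
  rw [mul_rpow (by positivity) (by positivity), ← rpow_mul (by positivity),
    ← rpow_mul (by positivity), mul_one_div_cancel hl.ne', rpow_one, mul_one_div,
    div_mul_cancel₀ _ hm.ne', show N + x * N = N * (1 + x) by ring,
    mul_rpow hN.le (by positivity), div_rpow (by positivity) hm.le, mul_rpow hx.le hN.le] at h1
  rw [rpow_neg hL.le, rpow_sub hN, ← div_eq_inv_mul, le_div_iff₀ (by positivity)]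
  refine (mul_le_mul_of_nonneg_left h1 (by positivity : 0 ≤ m ^ (-a))).trans (le_of_eq ?_)
  have : m ^ (-a) ≠ 0 := (by positivity : 0 < m ^ (-a)).ne'
  rw [rpow_neg hN.le]
  field_simp

variable {d : ℕ} {B R p lam : ℝ} {f : EuclideanSpace ℝ (Fin (d + 1)) → ℝ}

/-- The constant relating the moments of a radial weight to powers of the norm. -/
noncomputable def radialConst (d : ℕ) (p : ℝ) : ℝ :=
  2 * π ^ ((d : ℝ) / 2) * Gamma ((p + 1) / 2) /
    ((d + 1) * volume.real (Metric.ball (0 : EuclideanSpace ℝ (Fin (d + 1))) 1) *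
      Gamma ((p + (d + 1)) / 2))

/-- The integral of `(1 + ‖x‖ ^ p) ^ (-lam / (1 - lam))`. -/
noncomputable def holderConst (d : ℕ) (p lam : ℝ) : ℝ :=
  (d + 1) * volume.real (Metric.ball (0 : EuclideanSpace ℝ (Fin (d + 1))) 1) / p *
    (Gamma ((d + 1) / p) * Gamma (lam / (1 - lam) - (d + 1) / p) / Gamma (lam / (1 - lam)))

theorem volume_real_ball_pos (d : ℕ) :
    0 < volume.real (Metric.ball (0 : EuclideanSpace ℝ (Fin (d + 1))) 1) :=
  ENNReal.toReal_pos (Metric.measure_ball_pos _ _ one_pos).ne' measure_ball_lt_top.ne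

theorem radialConst_pos (hp : 0 ≤ p) : 0 < radialConst d p := by
  have h1 : 0 < Gamma ((p + (d + 1)) / 2) := Gamma_pos_of_pos (by positivity)
  have h2 : 0 < Gamma ((p + 1) / 2) := Gamma_pos_of_pos (by positivity)
  have h3 := volume_real_ball_pos d
  unfold radialConst
  positivity

theorem holderConst_pos (hp : 0 < p) (hlam : (d + 1) / p < lam / (1 - lam)) :
    0 < holderConst d p lam := by
  have h1 : 0 < Gamma (lam / (1 - lam) - (d + 1) / p) := Gamma_pos_of_pos (by linarith)
  have h2 : 0 < Gamma ((d + 1) / p) := Gamma_pos_of_pos (by positivity)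
  have h4 : 0 < Gamma (lam / (1 - lam)) := Gamma_pos_of_pos (lt_trans (by positivity) hlam)
  have h3 := volume_real_ball_pos d
  unfold holderConst
  positivity

theorem expMoment_le_ofReal (hf : IsProfile B R f) (hp : 1 ≤ p) (hlam0 : 0 < lam) (hlam1 : lam < 1)
    (hlam : (d + 1) / p < lam / (1 - lam)) {x : ℝ} (hx : 0 < x) (hN : 0 < ∫ y, f y)
    (hL : 0 < ∫ y, f y ^ lam) (r : ℝ) :
    expMoment p r f ≤ ENNReal.ofReal ((d + 1) *
      volume.real (Metric.ball (0 : EuclideanSpace ℝ (Fin (d + 1))) 1) *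
        (radialConst d p ^ (-((d + 1) / p)) * ((∫ y, f y ^ lam) ^ (-(1 / (1 - lam))) *
          ((∫ y, f y) ^ (lam / (1 - lam) - (d + 1) / p) * (1 + x) ^ (lam / (1 - lam)) *
            x ^ (-((d + 1) / p)) * holderConst d p lam)) * (1 / p) * Gamma ((d + 1) / p))) := by
  have hp0 : 0 < p := by linarith
  obtain ⟨g, hg, hrad⟩ := exists_admissible_radial hf hp r
  have hgN : ∫ y, g y = ∫ y, f y := by simpa using hg.integral_rpow 1 one_pos
  have hgL := hg.integral_rpow lam hlam0
  rw [← hgN] at hN ⊢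
  rw [← hgL] at hL ⊢
  have hκ : 0 < radialConst d p := radialConst_pos hp0.le
  have hω := volume_real_ball_pos d
  have hΓ : 0 < Gamma ((d + 1) / p) := Gamma_pos_of_pos (by positivity)
  set m := ∫ y, g y * ‖y‖ ^ p with hm
  have hcn : Continuous fun y : EuclideanSpace ℝ (Fin (d + 1)) => ‖y‖ ^ p :=
    continuous_norm.rpow_const fun _ => Or.inr hp0.le
  have hm0 : 0 < m := by
    have hnn : ∀ y, 0 ≤ g y * ‖y‖ ^ p := fun y => mul_nonneg (hg.profile.nonneg y) (by positivity)
    refine (integral_nonneg hnn).lt_of_ne' fun h0 => hN.ne' ?_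
    rw [← hm, integral_eq_zero_iff_of_nonneg hnn (hg.profile.integrable_mul hcn)] at h0
    refine integral_eq_zero_of_ae ?_
    have h1 : ∀ᵐ y : EuclideanSpace ℝ (Fin (d + 1)), y ≠ 0 := Measure.ae_ne volume 0
    filter_upwards [h0, h1] with y hy hy0
    have : ‖y‖ ^ p ≠ 0 := (rpow_pos_of_pos (norm_pos_iff.2 hy0) p).ne'
    simpa [this] using hy
  have hH := hg.profile.integral_rpow_le hp0 hlam0 hlam1 (β := x * (∫ y, g y) / m) (by positivity)
    (by simpa using hlam)
  rw [← hm, finrank_euclideanSpace_fin] at hH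
  push_cast at hH
  have hm1 := rpow_neg_le_of_le_mul_rpow (a := (d + 1) / p) hN hL hm0 (holderConst_pos hp0 hlam) hx
    hlam1 (hH.trans (le_of_eq (by rw [holderConst, neg_div]; ring_nf)))
  calc expMoment p r f ≤ expMoment p r g := by
        rw [← ofReal_integral_exp_neg_moment hf hp0.le,
          ← ofReal_integral_exp_neg_moment hg.profile hp0.le]
        exact ENNReal.ofReal_le_ofReal hg.le_integral_exp
    _ ≤ ∫⁻ y, ENNReal.ofReal (exp (-moment p g y)) := setLIntegral_le_lintegral _ _
    _ = ∫⁻ y : EuclideanSpace ℝ (Fin (d + 1)),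
          ENNReal.ofReal (exp (-(radialConst d p * m) * ‖y‖ ^ p)) := by
        refine lintegral_congr fun y => ?_
        rw [moment_eq_of_radial hg.profile hp0.le hrad, radialConst, neg_mul]
    _ ≤ _ := by
        rw [lintegral_exp_neg_mul_norm_rpow hp0 (by positivity), finrank_euclideanSpace_fin,
          mul_rpow hκ.le hm0.le]
        push_cast
        rw [neg_div]
        gcongr

theorem lintegral_exp_neg_moment_le (p : ℝ) {f : EuclideanSpace ℝ (Fin (d + 1)) → ℝ} {C : ℝ≥0∞}
    (h : ∀ r, expMoment p r f ≤ C) : ∫⁻ y, ENNReal.ofReal (exp (-moment p f y)) ≤ C := by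
  rw [← setLIntegral_univ, ← Metric.iUnion_closedBall_nat (0 : EuclideanSpace ℝ (Fin (d + 1))),
    setLIntegral_iUnion_of_directed _ (Monotone.directed_le fun i j hij =>
      Metric.closedBall_subset_closedBall (by exact_mod_cast hij))]
  exact iSup_le fun k => h k

end Radial

section Polar

variable {E : Type*} [NormedAddCommGroup E] [InnerProductSpace ℝ E] [FiniteDimensional ℝ E]
  [MeasurableSpace E] [BorelSpace E] {B R p : ℝ} {f : E → ℝ}

theorem moment_smul (p : ℝ) (f : E → ℝ) {r : ℝ} (hr : 0 ≤ r) (y : E) :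
    moment p f (r • y) = r ^ p * moment p f y := by
  rw [moment, moment, ← integral_const_mul]
  refine integral_congr_ae (ae_of_all _ fun x => ?_)
  simp only [inner_smul_right, abs_mul, abs_of_nonneg hr, mul_rpow hr (abs_nonneg _)]
  ring

theorem IsProfile.moment_pos (hf : IsProfile B R f) (hp : 0 ≤ p) (hne : f ≠ 0) {y : E}
    (hy : y ≠ 0) : 0 < moment p f y := by
  obtain ⟨x₀, hx₀⟩ := Function.ne_iff.1 hne
  have h1 : ∃ x, f x ≠ 0 ∧ ⟪x, y⟫ ≠ 0 := by
    by_cases h0 : ⟪x₀, y⟫ = 0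
    · have hc : Continuous fun t : ℝ => f (x₀ + t • y) := hf.continuous.comp (by fun_prop)
      have hev : ∀ᶠ t in nhdsWithin (0 : ℝ) {0}ᶜ, f (x₀ + t • y) ≠ 0 :=
        nhdsWithin_le_nhds (hc.continuousAt.eventually_ne (by simpa using hx₀))
      obtain ⟨t, ht, ht0⟩ := (hev.and self_mem_nhdsWithin).exists
      refine ⟨_, ht, ?_⟩
      rw [inner_add_left, h0, inner_smul_left, zero_add]
      exact mul_ne_zero (by simpa using ht0) (inner_self_ne_zero.2 hy)
    · exact ⟨x₀, hx₀, h0⟩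
  obtain ⟨x, hfx, hxy⟩ := h1
  refine Continuous.integral_pos_of_hasCompactSupport_nonneg_nonzero (x := x) ?_ ?_ ?_ ?_
  · exact hf.continuous.mul
      ((continuous_id.inner continuous_const).abs.rpow_const fun _ => Or.inr hp)
  · exact hf.hasCompactSupport.mul_right
  · exact fun z => mul_nonneg (hf.nonneg z) (by positivity)
  · exact mul_ne_zero hfx (rpow_pos_of_pos (abs_pos.2 hxy) p).ne'

theorem IsProfile.lintegral_exp_neg_moment [Nontrivial E] (hf : IsProfile B R f) (hp : 0 < p) (hne : f ≠ 0) :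
    ∫⁻ y, ENNReal.ofReal (exp (-moment p f y))
      = ENNReal.ofReal (1 / p * Gamma (Module.finrank ℝ E / p)) *
        ∫⁻ ξ : Metric.sphere (0 : E) 1, ENNReal.ofReal
          (moment p f ξ ^ (-(Module.finrank ℝ E : ℝ) / p)) ∂(volume : Measure E).toSphere := by
  have hms := measurable_moment hf.continuous hp.le
  rw [lintegral_eq_lintegral_toSphere (by fun_prop), ← lintegral_const_mul _ (by fun_prop)]
  refine lintegral_congr fun ξ => ?_
  have hξ : 0 < moment p f ξ := hf.moment_pos hp.le hne (by
    rintro h; simpa [h] using ξ.2)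
  have hΓ : 0 < Gamma (Module.finrank ℝ E / p) := Gamma_pos_of_pos
    (div_pos (by exact_mod_cast Module.finrank_pos) hp)
  have := lintegral_Ioi_pow_mul_exp (n := Module.finrank ℝ E) Module.finrank_pos le_rfl hp hξ
  rw [← ENNReal.ofReal_mul (by positivity)]
  rw [zero_add] at this
  rw [mul_comm, ← mul_assoc, ← this]
  refine setLIntegral_congr_fun measurableSet_Ioi fun r hr => ?_
  simp only [moment_smul p f (le_of_lt hr), rpow_zero, one_mul]
  congr 3
  ring

end Polar

section Constants

variable {d : ℕ} {p lam : ℝ}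

theorem volume_real_ball_euclideanSpace (d : ℕ) :
    volume.real (Metric.ball (0 : EuclideanSpace ℝ (Fin (d + 1))) 1)
      = π ^ (((d : ℝ) + 1) / 2) / Gamma (((d : ℝ) + 1) / 2 + 1) := by
  have h : 0 < Gamma (((d : ℝ) + 1) / 2 + 1) := Gamma_pos_of_pos (by positivity)
  rw [Measure.real, EuclideanSpace.volume_ball, Fintype.card_fin]
  push_cast
  rw [ENNReal.ofReal_one, one_pow, one_mul, ENNReal.toReal_ofReal (by positivity),
    ← rpow_natCast, sqrt_eq_rpow, ← rpow_mul pi_pos.le]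
  push_cast
  ring_nf

theorem Rnp_eq (hp : 0 < p) :
    Rnp (d + 1) p = volume.real (Metric.ball (0 : EuclideanSpace ℝ (Fin (d + 1))) 1) ^ 2 *
      (2 * ((d + 1) + p) / (d + 1) / radialConst d p) ^ (((d : ℝ) + 1) / p) := by
  have h1 : 0 < Gamma (((d : ℝ) + 1) / 2 + 1) := Gamma_pos_of_pos (by positivity)
  have h2 : 0 < Gamma ((p + 1) / 2) := Gamma_pos_of_pos (by positivity)
  have h3 : 0 < Gamma ((p + (d + 1)) / 2) := Gamma_pos_of_pos (by positivity)
  have hκ : 2 * ((d + 1) + p) / (d + 1) / radialConst d p = π ^ (1 / 2 : ℝ) *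
      (2 * Gamma (((d : ℝ) + 1 + p + 2) / 2) / (Gamma (((d : ℝ) + 1) / 2 + 1) *
        Gamma ((p + 1) / 2))) := by
    rw [radialConst, volume_real_ball_euclideanSpace,
      show ((d : ℝ) + 1 + p + 2) / 2 = (p + (d + 1)) / 2 + 1 by ring,
      Gamma_add_one (s := (p + (d + 1)) / 2) (by positivity),
      show ((d : ℝ) + 1) / 2 = d / 2 + 1 / 2 by ring, rpow_add pi_pos]
    rw [show ((d : ℝ) + 1) / 2 = d / 2 + 1 / 2 by ring] at h1
    field_simp
    ring
  have h4 : 0 < Gamma (((d : ℝ) + 1 + p + 2) / 2) := Gamma_pos_of_pos (by positivity)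
  rw [hκ, mul_rpow (by positivity) (by positivity), ← rpow_mul pi_pos.le, volume_real_ball_euclideanSpace, Rnp]
  push_cast
  rw [show ((d : ℝ) + 1 + 2) / 2 = ((d : ℝ) + 1) / 2 + 1 by ring, rpow_add pi_pos, div_pow,
    show π ^ ((d : ℝ) + 1) = (π ^ (((d : ℝ) + 1) / 2)) ^ 2 by
      rw [← rpow_natCast, ← rpow_mul pi_pos.le]; congr 1; push_cast; ring,
    show ((d : ℝ) + 1) / (2 * p) = 1 / 2 * ((d + 1) / p) by field_simp]
  ring

theorem anplLow_eq (hp : 0 < p) (hlam0 : 0 < lam) (hlam1 : lam < 1)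
    (hlam : (d + 1) / p < lam / (1 - lam)) {x : ℝ}
    (hx : x = (d + 1) / (lam / (1 - lam) * p - (d + 1))) :
    anplLow (d + 1) p lam = ((d + 1) / p * (1 + x) ^ (lam / (1 - lam)) * x ^ (-((d + 1) / p)) *
      (Gamma ((d + 1) / p) * Gamma (lam / (1 - lam) - (d + 1) / p) /
        Gamma (lam / (1 - lam)))) ^ p := by
  have hl : 0 < 1 - lam := by linarith
  set μ := lam / (1 - lam) with hμ
  have hμ0 : 0 < μ := by positivity
  have hlam' : lam / (lam - 1) = -μ := by
    rw [hμ, ← div_neg, neg_sub]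
  have hd : 0 < μ * p - (d + 1) := by
    rw [div_lt_iff₀ hp] at hlam; linarith
  have hx0 : 0 < x := by rw [hx]; positivity
  have h1x : 1 + x = μ * p / (μ * p - (d + 1)) := by rw [hx]; field_simp; ring
  have e1 : ((d : ℝ) + 1) / (-μ * p) + 1 = (1 + x)⁻¹ := by
    rw [h1x]; field_simp; ring
  have e2 : lam * p / ((1 - lam) * ((d : ℝ) + 1)) - 1 = x⁻¹ := by
    rw [hx, show lam * p / ((1 - lam) * ((d : ℝ) + 1)) = μ * p / (d + 1) by rw [hμ]; field_simp]
    field_simp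
  have e3 : Gamma (-(-μ) - ((d : ℝ) + 1) / p + 1)
      = (μ - (d + 1) / p) * Gamma (μ - (d + 1) / p) := by
    rw [neg_neg, Gamma_add_one (by linarith)]
  have e4 : Gamma (((d : ℝ) + 1) / p + (-(-μ) - ((d : ℝ) + 1) / p + 1)) = μ * Gamma μ := by
    rw [← Gamma_add_one hμ0.ne']; congr 1; ring
  have e5 : μ - (d + 1) / p = μ * (1 + x)⁻¹ := by
    rw [h1x]; field_simp
  have hΓ : 0 < Gamma μ := Gamma_pos_of_pos hμ0
  rw [anplLow, hlam']
  push_cast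
  rw [e1, e2, e3, e4, inv_rpow (by positivity), inv_rpow (by positivity), ← rpow_neg (by positivity),
    ← rpow_neg hx0.le, show -(-μ - 1) = μ + 1 by ring, rpow_add_one (by positivity)]
  congr 1
  generalize Gamma (μ - (d + 1) / p) = G
  rw [e5]
  field_simp

theorem two_rpow_neg_mul_bnplLow_eq (hp : 0 < p) (hlam0 : 0 < lam) (hlam1 : lam < 1)
    (hlam : (d + 1) / p < lam / (1 - lam)) {x : ℝ}
    (hx : x = (d + 1) / (lam / (1 - lam) * p - (d + 1))) :
    2 ^ (-((d : ℝ) + 1)) * bnplLow (d + 1) p lam = ((d + 1) *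
      volume.real (Metric.ball (0 : EuclideanSpace ℝ (Fin (d + 1))) 1) *
        radialConst d p ^ (-((d + 1) / p)) * ((1 + x) ^ (lam / (1 - lam)) * x ^ (-((d + 1) / p)) *
          holderConst d p lam)) ^ p := by
  have hω := volume_real_ball_pos d
  have hκ : 0 < radialConst d p := radialConst_pos hp.le
  have hd : 0 < lam / (1 - lam) * p - (d + 1) := by
    rw [div_lt_iff₀ hp] at hlam; linarith
  have hx0 : 0 < x := by rw [hx]; positivity
  have hJ := holderConst_pos hp hlam
  have hΓ : 0 < Gamma ((d + 1) / p) * Gamma (lam / (1 - lam) - (d + 1) / p) /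
      Gamma (lam / (1 - lam)) := by
    have h1 : 0 < Gamma (lam / (1 - lam) - (d + 1) / p) := Gamma_pos_of_pos (by linarith)
    have h2 : 0 < Gamma ((d + 1) / p) := Gamma_pos_of_pos (by positivity)
    have h4 : 0 < Gamma (lam / (1 - lam)) := Gamma_pos_of_pos (lt_trans (by positivity) hlam)
    positivity
  rw [bnplLow, anplLow_eq hp hlam0 hlam1 hlam hx, Rnp_eq hp, holderConst]
  push_cast
  generalize Gamma ((d + 1) / p) * Gamma (lam / (1 - lam) - (d + 1) / p) /
      Gamma (lam / (1 - lam)) = Bt at *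
  generalize volume.real (Metric.ball (0 : EuclideanSpace ℝ (Fin (d + 1))) 1) = ω at *
  generalize radialConst d p = κ at *
  have e1 : ((2 * ((d : ℝ) + 1 + p) / (d + 1) / κ) ^ (((d : ℝ) + 1) / p)) ^ p
      = 2 ^ ((d : ℝ) + 1) * (((d : ℝ) + 1) / (d + 1 + p)) ^ (-((d : ℝ) + 1)) *
        (κ ^ (-(((d : ℝ) + 1) / p))) ^ p := by
    rw [← rpow_mul (by positivity), ← rpow_mul hκ.le, div_mul_cancel₀ _ hp.ne', neg_mul,
      div_mul_cancel₀ _ hp.ne', rpow_neg (by positivity), rpow_neg hκ.le,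
      ← inv_rpow (by positivity), ← inv_rpow hκ.le, ← mul_rpow (by positivity) (by positivity),
      ← mul_rpow (by positivity) (by positivity)]
    congr 1
    field_simp
  have e2 : (((d : ℝ) + 1) / (d + 1 + p)) ^ (-((d : ℝ) + 1))
      = ((((d : ℝ) + 1) / (d + 1 + p)) ^ ((d : ℝ) + 1))⁻¹ := rpow_neg (by positivity) _
  have e3 : (2 : ℝ) ^ (-((d : ℝ) + 1)) = (2 ^ ((d : ℝ) + 1))⁻¹ := rpow_neg (by norm_num) _
  have h5 : (((d : ℝ) + 1) / (d + 1 + p)) ^ ((d : ℝ) + 1) ≠ 0 := by positivity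
  have h6 : (2 : ℝ) ^ ((d : ℝ) + 1) ≠ 0 := by positivity
  rw [mul_rpow (x := ω ^ 2) (by positivity) (by positivity), e1, e2, e3]
  generalize (((d : ℝ) + 1) / (d + 1 + p)) ^ ((d : ℝ) + 1) = u at *
  generalize (2 : ℝ) ^ ((d : ℝ) + 1) = w at *
  rw [show ∀ A B C D : ℝ, w⁻¹ * (u * A * (B * (w * u⁻¹ * C)) * D) = A * B * C * D by
      intros; field_simp,
    ← mul_rpow (by positivity) (by positivity), ← mul_rpow (by positivity) (by positivity),
    ← mul_rpow (by positivity) (by positivity)]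
  congr 1
  ring

end Constants

end Helpers

/-- Symmetric functional `L_p` Blaschke–Santaló inequality, case `λ ∈ (n/(n+p), 1)`. -/
theorem functional_BS_symmetric_low (n : ℕ) (hn : 2 ≤ n) (p : ℝ) (hp : 1 ≤ p)
    (lam : ℝ) (hlam_lo : (n : ℝ) / ((n : ℝ) + p) < lam) (hlam_hi : lam < 1)
    (f : EuclideanSpace ℝ (Fin n) → ℝ) (hf_cont : Continuous f)
    (hf_nonneg : ∀ x, 0 ≤ f x) (hf_supp : HasCompactSupport f) (hf_ne : f ≠ 0) :
    (∫ x, f x) ^ ((n : ℝ) + (lam / (lam - 1)) * p) ≤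
      2 ^ (-(n : ℝ)) * bnplLow n p lam *
        ((∫ x, |f x| ^ lam) ^ (1 / lam)) ^ ((lam / (lam - 1)) * p) *
        (∫ ξ : Metric.sphere (0 : EuclideanSpace ℝ (Fin n)) 1,
            (∫ x, f x * |⟪x, (ξ : EuclideanSpace ℝ (Fin n))⟫| ^ p) ^ (-(n : ℝ) / p)
          ∂((volume : Measure (EuclideanSpace ℝ (Fin n))).toSphere)) ^ (-p) := by
  obtain ⟨d, rfl⟩ : ∃ d, n = d + 1 := ⟨n - 1, by omega⟩
  have hp0 : 0 < p := by linarith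
  have hlam0 : 0 < lam := lt_trans (by positivity) hlam_lo
  have hl : 0 < 1 - lam := by linarith
  have hlam : ((d : ℝ) + 1) / p < lam / (1 - lam) := by
    rw [div_lt_iff₀ (by positivity)] at hlam_lo
    rw [div_lt_div_iff₀ hp0 hl]
    push_cast at hlam_lo
    linarith
  obtain ⟨B, hB⟩ := hf_cont.bounded_above_of_compact_support hf_supp
  obtain ⟨R, hR⟩ := hf_supp.isCompact.exists_bound_of_continuousOn continuousOn_id
  have hf : IsProfile B (R + 1) f := ⟨hf_cont, hf_nonneg, fun x => (le_abs_self _).trans (hB x),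
    fun x hx => image_eq_zero_of_notMem_tsupport fun h => by
      have : ‖x‖ ≤ R := hR x h
      linarith⟩
  obtain ⟨x₀, hx₀⟩ := Function.ne_iff.1 hf_ne
  have hN : 0 < ∫ x, f x :=
    hf_cont.integral_pos_of_hasCompactSupport_nonneg_nonzero hf_supp hf_nonneg hx₀
  have hL : 0 < ∫ x, f x ^ lam := by
    refine (hf_cont.rpow_const fun _ => Or.inr
      hlam0.le).integral_pos_of_hasCompactSupport_nonneg_nonzero (x := x₀) ?_
      (fun x => rpow_nonneg (hf_nonneg x) _)
      (rpow_pos_of_pos ((hf_nonneg x₀).lt_of_ne' hx₀) _).ne'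
    exact hf_supp.comp_left (g := fun t : ℝ => t ^ lam) (zero_rpow hlam0.ne')
  have hd : 0 < lam / (1 - lam) * p - (d + 1) := by
    have := hlam
    rw [div_lt_iff₀ hp0] at this; linarith
  set x : ℝ := (d + 1) / (lam / (1 - lam) * p - (d + 1)) with hx
  have hx0 : 0 < x := by positivity
  have hΓ : 0 < Gamma (((d : ℝ) + 1) / p) := Gamma_pos_of_pos (by positivity)
  have hpos : ∀ ξ : Metric.sphere (0 : EuclideanSpace ℝ (Fin (d + 1))) 1, 0 < moment p f ξ :=
    fun ξ => hf.moment_pos hp0.le hf_ne (by rintro h; simpa [h] using ξ.2)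
  have hle := lintegral_exp_neg_moment_le p
    (expMoment_le_ofReal hf hp hlam0 hlam_hi hlam hx0 hN hL)
  rw [hf.lintegral_exp_neg_moment hp0 hf_ne, finrank_euclideanSpace_fin] at hle
  have hω := volume_real_ball_pos d
  have hκ : 0 < radialConst d p := radialConst_pos hp0.le
  have hJ := holderConst_pos hp0 hlam
  have hb := two_rpow_neg_mul_bnplLow_eq hp0 hlam0 hlam_hi hlam hx
  set K := (d + 1) * volume.real (Metric.ball (0 : EuclideanSpace ℝ (Fin (d + 1))) 1) *
        radialConst d p ^ (-((d + 1) / p)) * ((1 + x) ^ (lam / (1 - lam)) * x ^ (-((d + 1) / p)) *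
          holderConst d p lam) with hK
  have hK0 : 0 < K := by positivity
  set N := ∫ x, f x
  set L := ∫ x, f x ^ lam
  set M := K * (L ^ (-(1 / (1 - lam))) * N ^ (lam / (1 - lam) - (d + 1) / p)) with hM
  have hM0 : 0 < M := by positivity
  have hmeas : Measurable fun ξ : Metric.sphere (0 : EuclideanSpace ℝ (Fin (d + 1))) 1 =>
      moment p f ξ ^ (-((d + 1 : ℕ) : ℝ) / p) :=
    ((measurable_moment hf_cont hp0.le).comp measurable_subtype_coe).pow_const _
  have hlin : ∫⁻ ξ : Metric.sphere (0 : EuclideanSpace ℝ (Fin (d + 1))) 1,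
      ENNReal.ofReal (moment p f ξ ^ (-((d + 1 : ℕ) : ℝ) / p)) ∂volume.toSphere
        ≤ ENNReal.ofReal M := by
    have hΓ' : 0 < 1 / p * Gamma (((d + 1 : ℕ) : ℝ) / p) := by push_cast; positivity
    refine (ENNReal.mul_le_mul_iff_right (ENNReal.ofReal_pos.2 hΓ').ne'
      ENNReal.ofReal_ne_top).1 (hle.trans (le_of_eq ?_))
    rw [← ENNReal.ofReal_mul hΓ'.le]
    congr 1
    rw [hM, hK]
    push_cast
    ring
  have hSeq := integral_eq_lintegral_of_nonneg_ae (μ := (volume : Measure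
      (EuclideanSpace ℝ (Fin (d + 1)))).toSphere) (ae_of_all _ fun ξ : Metric.sphere _ _ =>
      rpow_nonneg (hpos ξ).le (-((d + 1 : ℕ) : ℝ) / p)) hmeas.aestronglyMeasurable
  set S := ∫ ξ : Metric.sphere (0 : EuclideanSpace ℝ (Fin (d + 1))) 1,
    moment p f ξ ^ (-((d + 1 : ℕ) : ℝ) / p) ∂volume.toSphere with hS
  have hSM : S ≤ M := by
    rw [hSeq]
    exact ENNReal.toReal_le_of_le_ofReal hM0.le hlin
  have hS0 : 0 < S := by
    rw [hSeq]
    refine ENNReal.toReal_pos ?_ (hlin.trans_lt ENNReal.ofReal_lt_top).ne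
    rw [← pos_iff_ne_zero, lintegral_pos_iff_support (by fun_prop)]
    rw [show Function.support (fun ξ : Metric.sphere (0 : EuclideanSpace ℝ (Fin (d + 1))) 1 =>
      ENNReal.ofReal (moment p f ξ ^ (-((d + 1 : ℕ) : ℝ) / p))) = Set.univ from
        Set.eq_univ_of_forall fun ξ =>
          (ENNReal.ofReal_pos.2 (rpow_pos_of_pos (hpos ξ) _)).ne']
    rw [Measure.toSphere_apply_univ, finrank_euclideanSpace_fin, pos_iff_ne_zero]
    exact mul_ne_zero (by simp) (Metric.measure_ball_pos _ _ one_pos).ne'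
  have hSp : M ^ (-p) ≤ S ^ (-p) := rpow_le_rpow_of_nonpos hS0 hSM (by linarith)
  have habs : (∫ x, |f x| ^ lam) = L :=
    integral_congr_ae (ae_of_all _ fun x => by simp only [abs_of_nonneg (hf_nonneg x)])
  change _ ≤ _ * S ^ (-p)
  rw [habs]
  push_cast
  rw [hb, ← rpow_mul hL.le]
  have hlam' : lam / (lam - 1) = -(lam / (1 - lam)) := by
    rw [← div_neg, neg_sub]
  refine le_trans (le_of_eq ?_) (mul_le_mul_of_nonneg_left hSp (by positivity))
  clear_value K
  rw [hM, mul_rpow hK0.le (by positivity), mul_rpow (by positivity) (by positivity),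
    ← rpow_mul hL.le, ← rpow_mul hN.le, hlam', rpow_neg hK0.le,
    show (lam / (1 - lam) - ((d : ℝ) + 1) / p) * -p = (d : ℝ) + 1 + -(lam / (1 - lam)) * p by
      field_simp; ring,
    show -(1 / (1 - lam)) * -p = -(1 / lam * (-(lam / (1 - lam)) * p)) by field_simp,
    rpow_neg hL.le]
  have h1 : K ^ p ≠ 0 := (rpow_pos_of_pos hK0 p).ne'
  have h2 : L ^ (1 / lam * (-(lam / (1 - lam)) * p)) ≠ 0 := (rpow_pos_of_pos hL _).ne'
  field_simp
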